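/- arXiv:quant-ph/0311051 — 9 statements merged into one kernel-verified Lean document; each statement's English description precedes it below -/
import Mathlib

section
/- Compatible pair distributions on the edges of an acyclic graph always admit a joint distribution. Precisely: let V be a finite type, G a simple graph on V that is acyclic, and Ω a finite type. Suppose given for each vertex v a probability distribution p_v on Ω, and for each ordered pair (u,v) of adjacent vertices a probability distribution q_{u,v} on Ω × Ω satisfying the symmetry q_{u,v}(x,y) = q_{v,u}(y,x) and the compatibility condition ∑_{y ∈ Ω} q_{u,v}(x,y) = p_u(x) for all x. Then there exists a probability distribution P on the configuration space (V → Ω) such that for every pair of adjacent vertices u ≠ v and all x, y ∈ Ω, ∑_{f : V → Ω, f(u) = x, f(v) = y} P(f) = q_{u,v}(x,y), and for every vertex v and all x ∈ Ω, ∑_{f : V → Ω, f(v) = x} P(f) = p_v(x). -/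
/-- A probability distribution on a finite type. -/
def IsProbDist {Ω : Type*} [Fintype Ω] (p : Ω → ℝ) : Prop :=
  (∀ x, 0 ≤ p x) ∧ ∑ x, p x = 1

/-- A finite acyclic graph with an edge has a leaf. -/
theorem SimpleGraph.IsAcyclic.exists_adj_forall_adj_eq {V : Type*} [Finite V]
    {G : SimpleGraph V} (hG : G.IsAcyclic) (hne : G ≠ ⊥) :
    ∃ u v, G.Adj u v ∧ ∀ w, G.Adj v w → w = u := by
  obtain ⟨a, b, hab⟩ := SimpleGraph.ne_bot_iff_exists_adj.mp hne
  have : Nonempty V := ⟨a⟩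
  obtain ⟨v, t, c, hc, hmax⟩ := SimpleGraph.Walk.exists_isPath_forall_isPath_length_le_length G
  have hnil : ¬c.Nil := by
    intro hnil
    have := hmax _ _ hab.toWalk (SimpleGraph.Walk.IsPath.of_adj hab)
    simp [SimpleGraph.Walk.length_eq_zero_iff.mpr hnil] at this
  refine ⟨c.snd, v, (c.adj_snd hnil).symm, fun w hadj ↦ hG.eq_snd_of_adj_start hc hadj ?_⟩
  by_contra hw
  have := hmax _ _ _ (hc.cons (h := hadj.symm) hw)
  simp at this

section LeafExtension

variable {V Ω : Type*} [Fintype V] [DecidableEq V] [Fintype Ω]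

/-- The weight on configurations obtained from `P` by forgetting the coordinate `v` and resampling
it from the coordinate `u` through the kernel `K`. -/
noncomputable def resample (P : (V → Ω) → ℝ) (K : Ω → Ω → ℝ) (u v : V) (f : V → Ω) : ℝ :=
  (∑ a, P (Function.update f v a)) * K (f u) (f v)

theorem sum_resample_mul (P : (V → Ω) → ℝ) (K : Ω → Ω → ℝ) {u v : V} (huv : u ≠ v)
    (φ : (V → Ω) → ℝ) :
    ∑ f, resample P K u v f * φ f =
      ∑ f, P f * ∑ b, K (f u) b * φ (Function.update f v b) := by
  simp only [resample, Finset.sum_mul, Finset.mul_sum]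
  rw [← Fintype.sum_prod_type', ← Fintype.sum_prod_type']
  let e : (V → Ω) × Ω → (V → Ω) × Ω := fun z ↦ (Function.update z.1 v z.2, z.1 v)
  have he : Function.Involutive e := fun z ↦ by simp [e]
  refine Fintype.sum_equiv he.toPerm _ _ fun z ↦ ?_
  simp [e, Function.update_of_ne huv, mul_assoc]

/-- Resampling does not change expectations of functions that ignore the resampled coordinate. -/
theorem sum_resample_mul_of_update_eq {P : (V → Ω) → ℝ} {K : Ω → Ω → ℝ} {u v : V} (huv : u ≠ v)
    (hK : ∀ f, P f ≠ 0 → ∑ b, K (f u) b = 1) {φ : (V → Ω) → ℝ}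
    (hφ : ∀ f b, φ (Function.update f v b) = φ f) :
    ∑ f, resample P K u v f * φ f = ∑ f, P f * φ f := by
  rw [sum_resample_mul P K huv]
  refine Finset.sum_congr rfl fun f _ ↦ ?_
  rcases eq_or_ne (P f) 0 with h | h
  · simp [h]
  · simp [hφ, ← Finset.sum_mul, hK f h]

end LeafExtension

theorem sum_prod_filter_eq {V Ω : Type*} [Fintype V] [DecidableEq V] [Fintype Ω] [DecidableEq Ω]
    {p : V → Ω → ℝ} (hp : ∀ v, ∑ x, p v x = 1) (v : V) (x : Ω) :
    ∑ f : V → Ω with f v = x, ∏ w, p w (f w) = p v x := by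
  have h : ∀ f : V → Ω, (if f v = x then ∏ w, p w (f w) else 0) =
      ∏ w, if w = v then (if f w = x then p w (f w) else 0) else p w (f w) := by
    intro f
    split_ifs with hf
    · refine Finset.prod_congr rfl fun w _ ↦ ?_
      split_ifs <;> simp_all
    · exact (Finset.prod_eq_zero (Finset.mem_univ v) (by simp [hf])).symm
  rw [Finset.sum_filter, Finset.sum_congr rfl fun f _ ↦ h f,
    ← Fintype.prod_sum fun w a ↦ if w = v then (if a = x then p w a else 0) else p w a,
    Fintype.prod_eq_single v fun w hw ↦ by simp [hw, hp]]
  simp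


/-- Compatible pair distributions on the edges of an acyclic graph always admit
a joint distribution. -/
theorem acyclic_joint_distribution_exists
    {V Ω : Type*} [Fintype V] [DecidableEq V] [Fintype Ω] [DecidableEq Ω]
    (G : SimpleGraph V) (hG : G.IsAcyclic)
    (p : V → Ω → ℝ) (hp : ∀ v, IsProbDist (p v))
    (q : V → V → Ω × Ω → ℝ)
    (hq : ∀ u v, G.Adj u v → IsProbDist (q u v))
    (hsym : ∀ u v, G.Adj u v → ∀ x y, q u v (x, y) = q v u (y, x))
    (hcomp : ∀ u v, G.Adj u v → ∀ x, ∑ y, q u v (x, y) = p u x) :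
    ∃ P : (V → Ω) → ℝ, IsProbDist P ∧
      (∀ u v, G.Adj u v → ∀ x y,
        ∑ f ∈ Finset.univ.filter (fun f : V → Ω => f u = x ∧ f v = y), P f = q u v (x, y)) ∧
      (∀ v x, ∑ f ∈ Finset.univ.filter (fun f : V → Ω => f v = x), P f = p v x) := by
  induction G using WellFoundedLT.induction with
  | ind G ih =>
  rcases eq_or_ne G ⊥ with rfl | hne
  · refine ⟨fun f ↦ ∏ w, p w (f w), ⟨fun f ↦ Finset.prod_nonneg fun w _ ↦ (hp w).1 _, ?_⟩,
      fun u v h ↦ h.elim, sum_prod_filter_eq fun v ↦ (hp v).2⟩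
    rw [← Fintype.prod_sum]
    exact Finset.prod_eq_one fun v _ ↦ (hp v).2
  obtain ⟨u, v, huv, hleaf⟩ := hG.exists_adj_forall_adj_eq hne
  have hle : G.deleteEdges {s(u, v)} ≤ G := G.deleteEdges_le _
  have hlt : G.deleteEdges {s(u, v)} < G :=
    lt_of_le_of_ne hle fun h ↦ by
      rw [← h] at huv
      simp at huv
  obtain ⟨P, ⟨hP0, hP1⟩, hPq, hPp⟩ := ih _ hlt (hG.anti hle) (fun a b h ↦ hq a b (hle h))
    (fun a b h ↦ hsym a b (hle h)) (fun a b h ↦ hcomp a b (hle h))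
  have hne : u ≠ v := huv.ne
  let K : Ω → Ω → ℝ := fun x y ↦ q u v (x, y) / p u x
  have hK : ∀ f, P f ≠ 0 → ∑ b, K (f u) b = 1 := by
    intro f hf
    have hpos : 0 < p u (f u) := by
      rw [← hPp u (f u)]
      exact Finset.sum_pos' (fun g _ ↦ hP0 g) ⟨f, by simp, (hP0 f).lt_of_ne' hf⟩
    simp only [K]
    rw [← Finset.sum_div, hcomp u v huv, div_self hpos.ne']
  have hpK : ∀ x y, p u x * K x y = q u v (x, y) := by
    intro x y
    rcases eq_or_ne (p u x) 0 with h | h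
    · have := (Finset.sum_eq_zero_iff_of_nonneg fun b _ ↦ (hq u v huv).1 (x, b)).mp
        ((hcomp u v huv x).trans h) y (Finset.mem_univ y)
      simp [h, this]
    · exact mul_div_cancel₀ _ h
  let Q := resample P K u v
  have hQ : ∀ (s : (V → Ω) → Prop) [DecidablePred s],
      (∀ f b, s (Function.update f v b) ↔ s f) → ∑ f with s f, Q f = ∑ f with s f, P f := by
    intro s _ hs
    have := sum_resample_mul_of_update_eq hne hK (φ := fun f ↦ if s f then 1 else 0)
      fun f b ↦ by simp [hs]
    simpa [Finset.sum_filter] using this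
  have hQuv : ∀ x y, ∑ f with f u = x ∧ f v = y, Q f = q u v (x, y) := by
    intro x y
    have := sum_resample_mul P K hne fun f ↦ if f u = x ∧ f v = y then 1 else 0
    simp only [mul_ite, mul_one, mul_zero, Function.update_of_ne hne, Function.update_self] at this
    rw [Finset.sum_filter, this, ← hpK, ← hPp u x, Finset.sum_filter, Finset.sum_mul]
    refine Finset.sum_congr rfl fun f _ ↦ ?_
    by_cases hf : f u = x <;> simp [hf]
  have hQvu : ∀ x y, ∑ f with f v = x ∧ f u = y, Q f = q v u (x, y) := by
    intro x y
    rw [← hsym u v huv, ← hQuv]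
    simp only [and_comm]
  refine ⟨Q, ⟨fun f ↦ ?_, ?_⟩, fun a b hab x y ↦ ?_, fun w x ↦ ?_⟩
  · exact mul_nonneg (Finset.sum_nonneg fun _ _ ↦ hP0 _)
      (div_nonneg ((hq u v huv).1 _) ((hp u).1 _))
  · simpa [hP1] using hQ (fun _ ↦ True) (by simp)
  · by_cases hav : a = v
    · subst hav
      obtain rfl := hleaf b hab
      exact hQvu x y
    by_cases hbv : b = v
    · subst hbv
      obtain rfl := hleaf a hab.symm
      exact hQuv x y
    rw [hQ (fun f ↦ f a = x ∧ f b = y) (by simp [hav, hbv])]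
    exact hPq a b (by simp [SimpleGraph.deleteEdges_adj, hab, hav, hbv]) x y
  · by_cases hw : w = v
    · subst hw
      rw [← hcomp w u huv.symm, ← Finset.sum_fiberwise _ (fun f ↦ f u)]
      simp only [Finset.filter_filter, hQvu]
    · rw [hQ (fun f ↦ f w = x) (by simp [hw])]
      exact hPp w x
end

section
/- On an acyclic graph with strictly positive vertex marginals, the explicit product formula gives a valid joint distribution. Precisely: let V be a finite type, G a simple graph on V that is acyclic, and Ω a finite type. Suppose given for each vertex v a probability distribution p_v on Ω with p_v(x) > 0 for all x, and for each ordered pair (u,v) of adjacent vertices a probability distribution q_{u,v} on Ω × Ω satisfying q_{u,v}(x,y) = q_{v,u}(y,x) and ∑_{y ∈ Ω} q_{u,v}(x,y) = p_u(x) for all x. Define P : (V → Ω) → ℝ by P(f) = (∏ over unordered edges {u,v} of G of q_{u,v}(f(u), f(v))) · (∏ over vertices v of p_v(f(v))^{1 − deg(v)}), where deg(v) is the number of neighbors of v in G (this is well defined by the symmetry of q). Then P is a probability distribution on (V → Ω), for every pair of adjacent vertices u ≠ v, ∑_{f : f(u) = x, f(v) = y} P(f) = q_{u,v}(x,y), and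 for every vertex v, ∑_{f : f(v) = x} P(f) = p_v(x). -/
open Finset in
/-- Resampling coordinate `w` of a uniformly summed configuration. -/
theorem sum_eq_sum_mul_sum_update {V Ω : Type*} [Fintype V] [DecidableEq V] [Fintype Ω]
    (w : V) (a : Ω → ℝ) (ha : ∑ x, a x = 1) (F : (V → Ω) → ℝ) :
    ∑ f, F f = ∑ f : V → Ω, a (f w) * ∑ y, F (Function.update f w y) := by
  simp_rw [mul_sum]
  rw [← Fintype.sum_prod_type' (f := fun (f : V → Ω) y => a (f w) * F (Function.update f w y))]
  have hinv : Function.Involutive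
      (fun z : (V → Ω) × Ω => (Function.update z.1 w z.2, z.1 w)) := by
    rintro ⟨f, y⟩
    simp
  rw [← Equiv.sum_comp hinv.toPerm]
  simp only [Function.Involutive.coe_toPerm, Function.update_self, Function.update_idem,
    Function.update_eq_self]
  rw [Fintype.sum_prod_type]
  simp_rw [← sum_mul, ha, one_mul]

namespace SimpleGraph

/-- A finite acyclic graph with an edge has a vertex with exactly one neighbour. -/
theorem IsAcyclic.exists_unique_neighbor {V : Type*} [Finite V] {G : SimpleGraph V}
    (hG : G.IsAcyclic) {a b : V} (hab : G.Adj a b) :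
    ∃ u w, G.Adj u w ∧ ∀ v, G.Adj w v → v = u := by
  have : Nonempty V := ⟨a⟩
  obtain ⟨w, z, r, hr, hmax⟩ := Walk.exists_isPath_forall_isPath_length_le_length G
  have hnil : ¬ r.Nil := by
    intro h
    have h1 := hmax a b hab.toWalk (by simpa using hab.ne)
    have h2 := Walk.length_eq_zero_iff.mpr h
    simp [h2] at h1
  refine ⟨_, w, (r.adj_snd hnil).symm, fun v hadj => ?_⟩
  apply hG.eq_snd_of_adj_start hr hadj
  have : ¬ (r.cons hadj.symm).IsPath := by grind [Walk.length_cons]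
  grind [hr.cons]

section

variable {V Ω : Type*} (p : V → Ω → ℝ) (q : V → V → Ω × Ω → ℝ)

/-- The density of the (symmetrized) law `q` on an edge relative to the product of the
vertex laws `p` of its endpoints, at the configuration `f`. -/
noncomputable def edgeRatio (f : V → Ω) : Sym2 V → ℝ :=
  Sym2.lift ⟨fun u v => (q u v (f u, f v) + q v u (f v, f u)) / 2 / (p u (f u) * p v (f v)),
    by intro u v; ring⟩

/-- The product of the vertex laws times the product of the edge densities. -/
noncomputable def treeWeight [Fintype V] (G : SimpleGraph V) [Fintype G.edgeSet]
    (f : V → Ω) : ℝ :=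
  (∏ e ∈ G.edgeFinset, edgeRatio p q f e) * ∏ v, p v (f v)

variable {p q}

theorem edgeRatio_update_of_notMem [DecidableEq V] {e : Sym2 V} {w : V} (hw : w ∉ e)
    (f : V → Ω) (y : Ω) :
    edgeRatio p q (Function.update f w y) e = edgeRatio p q f e := by
  induction e with
  | _ a b =>
    rw [Sym2.mem_iff, not_or] at hw
    simp [edgeRatio, Function.update_of_ne (Ne.symm hw.1), Function.update_of_ne (Ne.symm hw.2)]

theorem edgeRatio_mk {u v : V} (hsym : ∀ x y, q u v (x, y) = q v u (y, x)) (f : V → Ω) :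
    edgeRatio p q f s(u, v) = q u v (f u, f v) / (p u (f u) * p v (f v)) := by
  simp [edgeRatio, ← hsym]

/-- Exchanging vertex and edge products: a vertex factor occurs once per incident edge. -/
theorem prod_pow_degree_eq_prod_edgeFinset [Fintype V] [DecidableEq V] (G : SimpleGraph V)
    [DecidableRel G.Adj] (a : V → ℝ) :
    ∏ v, a v ^ G.degree v =
      ∏ e ∈ G.edgeFinset, Sym2.lift ⟨fun u v => a u * a v, fun _ _ => mul_comm _ _⟩ e := by
  have h (v : V) : a v ^ G.degree v = ∏ e ∈ G.edgeFinset, if v ∈ e then a v else 1 := by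
    rw [← Finset.prod_filter, Finset.prod_const, ← card_incidenceFinset_eq_degree,
      incidenceFinset_eq_filter]
  simp_rw [h]
  rw [Finset.prod_comm]
  refine Finset.prod_congr rfl fun e he => ?_
  induction e with
  | _ x y =>
    have hne : x ≠ y := (mem_edgeFinset.mp he : G.Adj x y).ne
    rw [← Finset.prod_filter, show Finset.univ.filter (· ∈ s(x, y)) = {x, y} by ext; simp,
      Finset.prod_pair hne, Sym2.lift_mk]

theorem prod_mul_prod_zpow_eq_treeWeight [Fintype V] [DecidableEq V] (G : SimpleGraph V)
    [DecidableRel G.Adj] (hpos : ∀ v x, 0 < p v x) (f : V → Ω) :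
    (∏ e ∈ G.edgeFinset,
        Sym2.lift ⟨fun u v => (q u v (f u, f v) + q v u (f v, f u)) / 2,
          by intro u v; ring⟩ e) *
      (∏ v, (p v (f v)) ^ ((1 : ℤ) - (G.degree v : ℤ))) = treeWeight p q G f := by
  have h (v : V) : (p v (f v)) ^ ((1 : ℤ) - (G.degree v : ℤ)) =
      p v (f v) / p v (f v) ^ G.degree v := by
    rw [zpow_sub₀ (hpos v _).ne', zpow_one, zpow_natCast]
  simp_rw [h]
  rw [Finset.prod_div_distrib, prod_pow_degree_eq_prod_edgeFinset G fun v => p v (f v),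
    ← mul_div_assoc, mul_div_right_comm, ← Finset.prod_div_distrib, treeWeight]
  congr 1
  refine Finset.prod_congr rfl fun e _ => ?_
  induction e with
  | _ x y => rfl

/-- Summing out a leaf `w` with neighbour `u` replaces `G` by the graph without that edge. -/
theorem sum_treeWeight_mul_of_leaf [Fintype V] [Fintype Ω] [DecidableEq V]
    {G : SimpleGraph V} [DecidableRel G.Adj] (hpos : ∀ v x, 0 < p v x) {u w : V}
    (hp : ∑ x, p w x = 1) (hsym : ∀ x y, q u w (x, y) = q w u (y, x))
    (huw : G.Adj u w) (hleaf : ∀ v, G.Adj w v → v = u)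
    [Fintype (G.deleteEdges {s(u, w)}).edgeSet] (F : (V → Ω) → ℝ) :
    ∑ f, treeWeight p q G f * F f =
      ∑ f, treeWeight p q (G.deleteEdges {s(u, w)}) f *
        ∑ y, q u w (f u, y) / p u (f u) * F (Function.update f w y) := by
  generalize hdel : G.deleteEdges {s(u, w)} = G' at *
  have hedge : G.edgeFinset = insert s(u, w) G'.edgeFinset := by
    ext e
    by_cases h : e = s(u, w) <;> simp [← hdel, h, huw]
  have hnot : s(u, w) ∉ G'.edgeFinset := by simp [← hdel]
  have hw : ∀ e ∈ G'.edgeFinset, w ∉ e := by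
    rintro e he ⟨v, rfl⟩
    simp only [← hdel, mem_edgeFinset, edgeSet_deleteEdges, Set.mem_sdiff, mem_edgeSet,
      Set.mem_singleton_iff] at he
    exact he.2 (by rw [hleaf v he.1, Sym2.eq_swap])
  set R : (V → Ω) → ℝ := fun f =>
    (∏ e ∈ G'.edgeFinset, edgeRatio p q f e) * ∏ v ∈ Finset.univ.erase w, p v (f v) with hR
  have hRupd (f : V → Ω) (y : Ω) : R (Function.update f w y) = R f := by
    simp only [hR]
    congr 1
    · exact Finset.prod_congr rfl fun e he => edgeRatio_update_of_notMem (hw e he) f y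
    · exact Finset.prod_congr rfl fun v hv => by
        rw [Function.update_of_ne (Finset.ne_of_mem_erase hv)]
  have hG' (f : V → Ω) : treeWeight p q G' f = p w (f w) * R f := by
    rw [treeWeight, ← Finset.mul_prod_erase _ _ (Finset.mem_univ w)]
    ring
  have hGR (f : V → Ω) : treeWeight p q G f = R f * (q u w (f u, f w) / p u (f u)) := by
    have h1 := (hpos u (f u)).ne'
    have h2 := (hpos w (f w)).ne'
    rw [treeWeight, hedge, Finset.prod_insert hnot, edgeRatio_mk hsym,
      ← Finset.mul_prod_erase _ _ (Finset.mem_univ w)]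
    simp only [hR]
    field_simp
  rw [sum_eq_sum_mul_sum_update w (p w) hp]
  refine Finset.sum_congr rfl fun f _ => ?_
  rw [hG', mul_assoc, Finset.mul_sum _ _ (R f)]
  congr 1
  refine Finset.sum_congr rfl fun y _ => ?_
  rw [hGR, hRupd, Function.update_self, Function.update_of_ne huw.ne, mul_assoc]

theorem sum_treeWeight_of_forall_not_adj [Fintype V] [Fintype Ω] [DecidableEq V]
    {G : SimpleGraph V} [Fintype G.edgeSet] (hp : ∀ v, ∑ x, p v x = 1)
    (hG : ∀ u v, ¬ G.Adj u v) (v : V) (φ : Ω → ℝ) :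
    ∑ f, treeWeight p q G f * φ (f v) = ∑ x, p v x * φ x := by
  obtain rfl : G = ⊥ := by
    ext u v
    simp [hG u v]
  have hw (f : V → Ω) : treeWeight p q ⊥ f * φ (f v) =
      ∏ w, p w (f w) * (if w = v then φ (f w) else 1) := by
    have hE : (⊥ : SimpleGraph V).edgeFinset = ∅ := by
      ext
      simp
    simp [treeWeight, hE, Finset.prod_mul_distrib, -mul_ite]
  simp_rw [hw]
  rw [← Fintype.prod_sum fun w x => p w x * (if w = v then φ x else 1),
    Finset.prod_eq_single_of_mem v (Finset.mem_univ v) fun w _ h => by simp [h, hp w]]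
  simp

/-- The vertex and edge expectations under the tree weight of an acyclic graph. -/
theorem IsAcyclic.sum_treeWeight_mul [Fintype V] [Fintype Ω] [DecidableEq V]
    (hp : ∀ v, ∑ x, p v x = 1) (hpos : ∀ v x, 0 < p v x) (n : ℕ) :
    ∀ (G : SimpleGraph V) [DecidableRel G.Adj], G.IsAcyclic → G.edgeFinset.card = n →
    (∀ u v, G.Adj u v → ∀ x y, q u v (x, y) = q v u (y, x)) →
    (∀ u v, G.Adj u v → ∀ x, ∑ y, q u v (x, y) = p u x) →
    (∀ v (φ : Ω → ℝ), ∑ f, treeWeight p q G f * φ (f v) = ∑ x, p v x * φ x) ∧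
    (∀ u v, G.Adj u v → ∀ φ : Ω → Ω → ℝ,
      ∑ f, treeWeight p q G f * φ (f u) (f v) = ∑ x, ∑ y, q u v (x, y) * φ x y) := by
  induction n with
  | zero =>
    intro G _ _ hcard _ _
    have hno (u v : V) : ¬ G.Adj u v := fun h => by
      have := Finset.card_eq_zero.mp hcard ▸ mem_edgeFinset.mpr (G.mem_edgeSet.mpr h)
      simp at this
    exact ⟨fun v φ => sum_treeWeight_of_forall_not_adj hp hno v φ,
      fun u v h => (hno u v h).elim⟩
  | succ n ih =>
    classical
    intro G _ hG hcard hsym hcomp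
    obtain ⟨e, he⟩ := Finset.card_pos.mp (n.succ_pos.trans_eq hcard.symm)
    obtain ⟨u, w, huw, hleaf⟩ : ∃ u w, G.Adj u w ∧ ∀ v, G.Adj w v → v = u := by
      induction e with
      | _ a b => exact hG.exists_unique_neighbor (mem_edgeFinset.mp he)
    have hle : G.deleteEdges {s(u, w)} ≤ G := deleteEdges_le _
    have hcard' : (G.deleteEdges {s(u, w)}).edgeFinset.card = n := by
      have hE : (G.deleteEdges {s(u, w)}).edgeFinset = G.edgeFinset.erase s(u, w) := by
        ext e
        simp [and_comm]
      rw [hE, Finset.card_erase_of_mem (mem_edgeFinset.mpr huw), hcard, Nat.add_sub_cancel]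
    obtain ⟨ihv, ihe⟩ := ih (G.deleteEdges {s(u, w)}) (hG.anti hle) hcard'
      (fun a b h => hsym a b (hle h)) (fun a b h => hcomp a b (hle h))
    have step := sum_treeWeight_mul_of_leaf hpos (hp w) (hsym u w huw) huw hleaf
    have hone (x : Ω) : ∑ y, q u w (x, y) / p u x = 1 := by
      rw [← Finset.sum_div, hcomp u w huw, div_self (hpos u x).ne']
    have edge (φ : Ω → Ω → ℝ) :
        ∑ f, treeWeight p q G f * φ (f u) (f w) = ∑ x, ∑ y, q u w (x, y) * φ x y := by
      rw [step fun f => φ (f u) (f w)]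
      simp only [Function.update_self, Function.update_of_ne huw.ne]
      rw [ihv u fun x => ∑ y, q u w (x, y) / p u x * φ x y]
      refine Finset.sum_congr rfl fun x _ => ?_
      rw [Finset.mul_sum]
      refine Finset.sum_congr rfl fun y _ => ?_
      have := (hpos u x).ne'
      field_simp
    refine ⟨fun v φ => ?_, fun a b hab φ => ?_⟩
    · by_cases hv : v = w
      · subst hv
        rw [edge fun _ y => φ y, Finset.sum_comm]
        refine Finset.sum_congr rfl fun y _ => ?_
        simp_rw [← Finset.sum_mul, hsym u v huw, hcomp v u huw.symm]
      · rw [step fun f => φ (f v), ← ihv v φ]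
        simp only [Function.update_of_ne hv, ← Finset.sum_mul, hone, one_mul]
    · by_cases hb : b = w
      · subst hb
        obtain rfl := hleaf a hab.symm
        exact edge φ
      by_cases ha : a = w
      · subst ha
        obtain rfl := hleaf b hab
        rw [edge fun x y => φ y x, Finset.sum_comm]
        simp_rw [hsym b a huw]
      · rw [step fun f => φ (f a) (f b), ← ihe a b (by simp [hab, ha, hb]) φ]
        simp only [Function.update_of_ne ha, Function.update_of_ne hb, ← Finset.sum_mul, hone,
          one_mul]

end

end SimpleGraph


/-- On an acyclic graph with strictly positive vertex marginals, the explicit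
product formula
`P f = (∏ edges {u,v}, q u v (f u, f v)) * (∏ v, (p v (f v)) ^ (1 - deg v))`
gives a valid joint distribution.  The factor on an unordered edge is expressed
via `Sym2.lift` applied to the symmetrization `(q u v (f u, f v) + q v u (f v, f u))/2`,
which by the symmetry hypothesis agrees with `q u v (f u, f v)` on every edge. -/
theorem acyclic_product_formula_joint_distribution
    {V Ω : Type*} [Fintype V] [DecidableEq V] [Fintype Ω] [DecidableEq Ω]
    (G : SimpleGraph V) [DecidableRel G.Adj] (hG : G.IsAcyclic)
    (p : V → Ω → ℝ) (hp : ∀ v, IsProbDist (p v)) (hpos : ∀ v x, 0 < p v x)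
    (q : V → V → Ω × Ω → ℝ)
    (hq : ∀ u v, G.Adj u v → IsProbDist (q u v))
    (hsym : ∀ u v, G.Adj u v → ∀ x y, q u v (x, y) = q v u (y, x))
    (hcomp : ∀ u v, G.Adj u v → ∀ x, ∑ y, q u v (x, y) = p u x)
    (P : (V → Ω) → ℝ)
    (hP : ∀ f, P f =
      (∏ e ∈ G.edgeFinset,
        Sym2.lift ⟨fun u v => (q u v (f u, f v) + q v u (f v, f u)) / 2,
          by intro u v; ring⟩ e) *
      (∏ v, (p v (f v)) ^ ((1 : ℤ) - (G.degree v : ℤ)))) :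
    IsProbDist P ∧
    (∀ u v, G.Adj u v → ∀ x y,
      ∑ f ∈ Finset.univ.filter (fun f : V → Ω => f u = x ∧ f v = y), P f = q u v (x, y)) ∧
    (∀ v x, ∑ f ∈ Finset.univ.filter (fun f : V → Ω => f v = x), P f = p v x) := by
  have hPW (f : V → Ω) : P f = G.treeWeight p q f :=
    (hP f).trans (G.prod_mul_prod_zpow_eq_treeWeight hpos f)
  obtain ⟨hvert, hedge⟩ := SimpleGraph.IsAcyclic.sum_treeWeight_mul (fun v => (hp v).2) hpos _ G
    hG rfl hsym hcomp
  simp_rw [← hPW] at hvert hedge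
  refine ⟨⟨fun f => ?_, ?_⟩, fun u v huv x y => ?_, fun v x => ?_⟩
  · rw [hP]
    refine mul_nonneg (Finset.prod_nonneg fun e he => ?_)
      (Finset.prod_nonneg fun v _ => zpow_nonneg (hpos v _).le _)
    induction e with
    | _ a b =>
      have hab : G.Adj a b := SimpleGraph.mem_edgeFinset.mp he
      exact div_nonneg (add_nonneg ((hq a b hab).1 _) ((hq b a hab.symm).1 _)) zero_le_two
  · rcases isEmpty_or_nonempty V with _ | ⟨⟨v⟩⟩
    · simp [hP, Finset.prod_of_isEmpty]
    · simpa [(hp v).2] using hvert v fun _ => 1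
  · have h := hedge u v huv fun a b => if a = x ∧ b = y then 1 else 0
    simpa [Finset.sum_filter, ite_and] using h
  · have h := hvert v fun a => if a = x then 1 else 0
    simpa [Finset.sum_filter] using h
end

section
/- If a joint distribution for all pair distributions exists, then the correlations admit a (deterministic) local hidden variable model. Precisely: let α, β be finite types, m, k natural numbers, and P : Fin m → Fin k → (α × β → ℝ) a family of pair distributions. Suppose there exists a probability distribution μ on ((Fin m → α) × (Fin k → β)) such that for all i, j, x, y: ∑_{(a,b) with a(i) = x, b(j) = y} μ(a,b) = P i j (x,y). Then there exist a finite type Λ, a probability distribution M on Λ, and response functions χA : Fin m → α → Λ → ℝ and χB : Fin k → β → Λ → ℝ, each taking only the values 0 and 1 and satisfying ∑_{x ∈ α} χA i x λ = 1 and ∑_{y ∈ β} χB j y λ = 1 for all i, j, λ, such that P i j (x,y) = ∑_{λ ∈ Λ} M(λ) · χA i x λ · χB j y λ for all i, j, x, y. -/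
/-- If a joint distribution for all pair distributions exists, then the correlations
admit a (deterministic) local hidden variable model. -/
theorem joint_distribution_gives_lhv
    {α β : Type*} [Fintype α] [DecidableEq α] [Fintype β] [DecidableEq β]
    (m k : ℕ) (P : Fin m → Fin k → α × β → ℝ)
    (μ : (Fin m → α) × (Fin k → β) → ℝ) (hμ : IsProbDist μ)
    (hmarg : ∀ (i : Fin m) (j : Fin k) (x : α) (y : β),
      ∑ ab ∈ Finset.univ.filter
          (fun ab : (Fin m → α) × (Fin k → β) => ab.1 i = x ∧ ab.2 j = y), μ ab
        = P i j (x, y)) :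
    ∃ (Λ : Type) (instΛ : Fintype Λ) (M : Λ → ℝ)
      (χA : Fin m → α → Λ → ℝ) (χB : Fin k → β → Λ → ℝ),
      IsProbDist M ∧
      (∀ i x l, χA i x l = 0 ∨ χA i x l = 1) ∧
      (∀ j y l, χB j y l = 0 ∨ χB j y l = 1) ∧
      (∀ i l, ∑ x, χA i x l = 1) ∧
      (∀ j l, ∑ y, χB j y l = 1) ∧
      (∀ i j x y, P i j (x, y) = ∑ l, M l * χA i x l * χB j y l) := by
  classical
  let e := (Fintype.equivFin ((Fin m → α) × (Fin k → β))).symm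
  refine ⟨Fin (Fintype.card ((Fin m → α) × (Fin k → β))), inferInstance, fun l => μ (e l),
    fun i x l => if (e l).1 i = x then 1 else 0, fun j y l => if (e l).2 j = y then 1 else 0,
    ⟨fun l => hμ.1 _, (e.sum_comp μ).trans hμ.2⟩, ?_, ?_, ?_, ?_, ?_⟩
  · intro i x l
    exact (ite_eq_or_eq _ _ _).symm
  · intro j y l
    exact (ite_eq_or_eq _ _ _).symm
  · intro i l
    simp
  · intro j l
    simp
  · intro i j x y
    rw [← hmarg, Finset.sum_filter, ← e.sum_comp]
    refine Finset.sum_congr rfl fun l _ => ?_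
    by_cases hx : (e l).1 i = x <;> by_cases hy : (e l).2 j = y <;> simp [hx, hy]
end

section
/- A local hidden variable model yields a joint distribution for all its pair distributions. Precisely: let α, β be finite types, m, k natural numbers, (Λ, 𝓜) a measurable space with a probability measure M, and suppose given measurable response functions χA : Fin m → α → Λ → ℝ and χB : Fin k → β → Λ → ℝ with 0 ≤ χA i x λ, ∑_{x ∈ α} χA i x λ = 1, 0 ≤ χB j y λ, and ∑_{y ∈ β} χB j y λ = 1 for all i, j, λ. Define P_joint : (Fin m → α) × (Fin k → β) → ℝ by P_joint(a,b) = ∫_Λ (∏_{i} χA i (a i) λ) · (∏_{j} χB j (b j) λ) dM(λ). Then P_joint is a probability distribution on (Fin m → α) × (Fin k → β), and for all i, j, x, y: ∑_{(a,b) with a(i) = x, b(j) = y} P_joint(a,b) = ∫_Λ χA i x λ · χB j y λ dM(λ). -/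
open MeasureTheory

/-- The total mass of a product of finite distributions is one. -/
lemma sum_pi_prod_eq_one {ι α : Type*} [Fintype ι] [DecidableEq ι] [Fintype α]
    (f : ι → α → ℝ) (hf : ∀ i, ∑ x, f i x = 1) :
    ∑ a : ι → α, ∏ i, f i (a i) = 1 := by
  rw [← Fintype.piFinset_univ, ← Finset.prod_univ_sum]
  simp [hf]

/-- The marginals of a product of finite distributions are its factors. -/
lemma sum_filter_pi_prod_eq {ι α : Type*} [Fintype ι] [DecidableEq ι] [Fintype α] [DecidableEq α]
    (f : ι → α → ℝ) (hf : ∀ i, ∑ x, f i x = 1) (i : ι) (x : α) :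
    ∑ a : ι → α with a i = x, ∏ i', f i' (a i') = f i x := by
  have h : (Finset.univ.filter fun a : ι → α => a i = x) =
      Fintype.piFinset (Function.update (fun _ : ι => (Finset.univ : Finset α)) i {x}) := by
    ext a
    simp only [Finset.mem_filter, Finset.mem_univ, true_and, Fintype.mem_piFinset]
    refine ⟨fun ha j => ?_, fun ha => by simpa using ha i⟩
    obtain rfl | hj := eq_or_ne j i
    · simp [ha]
    · simp [Function.update_of_ne hj]
  rw [h, ← Finset.prod_univ_sum, Finset.prod_eq_single i]
  · simp
  · intro j _ hj
    simp [Function.update_of_ne hj, hf]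
  · simp

/-- A product of finitely many measurable response functions with values in `[0, 1]` is
integrable. -/
lemma integrable_prod_mul_prod {ι κ Λ : Type*} [Fintype ι] [Fintype κ] [MeasurableSpace Λ]
    (M : Measure Λ) [IsFiniteMeasure M] (f : ι → Λ → ℝ) (g : κ → Λ → ℝ)
    (hf : ∀ i, Measurable (f i)) (hg : ∀ j, Measurable (g j))
    (hf0 : ∀ i l, 0 ≤ f i l) (hf1 : ∀ i l, f i l ≤ 1)
    (hg0 : ∀ j l, 0 ≤ g j l) (hg1 : ∀ j l, g j l ≤ 1) :
    Integrable (fun l => (∏ i, f i l) * ∏ j, g j l) M := by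
  refine Integrable.of_bound (C := 1) ?_ (.of_forall fun l => ?_)
  · exact ((Finset.measurable_fun_prod _ fun i _ => hf i).mul
      (Finset.measurable_fun_prod _ fun j _ => hg j)).aestronglyMeasurable
  · have hF0 := Finset.prod_nonneg fun i (_ : i ∈ Finset.univ) => hf0 i l
    have hG0 := Finset.prod_nonneg fun j (_ : j ∈ Finset.univ) => hg0 j l
    rw [Real.norm_of_nonneg (mul_nonneg hF0 hG0)]
    exact mul_le_one₀ (Finset.prod_le_one (fun i _ => hf0 i l) fun i _ => hf1 i l) hG0
      (Finset.prod_le_one (fun j _ => hg0 j l) fun j _ => hg1 j l)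

/-- A local hidden variable model yields a joint distribution for all its
pair distributions. -/
theorem lhv_gives_joint_distribution
    {α β : Type*} [Fintype α] [DecidableEq α] [Fintype β] [DecidableEq β]
    (m k : ℕ)
    {Λ : Type*} [MeasurableSpace Λ] (M : Measure Λ) [IsProbabilityMeasure M]
    (χA : Fin m → α → Λ → ℝ) (χB : Fin k → β → Λ → ℝ)
    (hmA : ∀ i x, Measurable (χA i x)) (hmB : ∀ j y, Measurable (χB j y))
    (hA0 : ∀ i x l, 0 ≤ χA i x l) (hA1 : ∀ i l, ∑ x, χA i x l = 1)
    (hB0 : ∀ j y l, 0 ≤ χB j y l) (hB1 : ∀ j l, ∑ y, χB j y l = 1)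
    (Pjoint : (Fin m → α) × (Fin k → β) → ℝ)
    (hP : ∀ a b, Pjoint (a, b) =
      ∫ l, (∏ i, χA i (a i) l) * (∏ j, χB j (b j) l) ∂M) :
    IsProbDist Pjoint ∧
    (∀ (i : Fin m) (j : Fin k) (x : α) (y : β),
      ∑ ab ∈ Finset.univ.filter
          (fun ab : (Fin m → α) × (Fin k → β) => ab.1 i = x ∧ ab.2 j = y), Pjoint ab
        = ∫ l, χA i x l * χB j y l ∂M) := by
  have hA_le i x l : χA i x l ≤ 1 := by
    rw [← hA1 i l]
    exact Finset.single_le_sum (fun x _ => hA0 i x l) (Finset.mem_univ x)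
  have hB_le j y l : χB j y l ≤ 1 := by
    rw [← hB1 j l]
    exact Finset.single_le_sum (fun y _ => hB0 j y l) (Finset.mem_univ y)
  have hsum (s : Finset (Fin m → α)) (t : Finset (Fin k → β)) :
      ∑ ab ∈ s ×ˢ t, Pjoint ab =
        ∫ l, (∑ a ∈ s, ∏ i, χA i (a i) l) * (∑ b ∈ t, ∏ j, χB j (b j) l) ∂M := by
    simp_rw [Finset.sum_mul_sum, ← Finset.sum_product']
    rw [integral_finsetSum]
    · exact Finset.sum_congr rfl fun ab _ => hP ab.1 ab.2
    · exact fun ab _ => integrable_prod_mul_prod M _ _ (fun i => hmA i _) (fun j => hmB j _)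
        (fun i => hA0 i _) (fun i => hA_le i _) (fun j => hB0 j _) (fun j => hB_le j _)
  refine ⟨⟨fun ⟨a, b⟩ => ?_, ?_⟩, fun i j x y => ?_⟩
  · rw [hP]
    exact integral_nonneg fun l => mul_nonneg (Finset.prod_nonneg fun i _ => hA0 i _ l)
      (Finset.prod_nonneg fun j _ => hB0 j _ l)
  · rw [← Finset.univ_product_univ, hsum]
    simp [sum_pi_prod_eq_one (fun i x => χA i x _) fun i => hA1 i _,
      sum_pi_prod_eq_one (fun j y => χB j y _) fun j => hB1 j _]
  · rw [← Finset.univ_product_univ,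
      Finset.filter_product (fun a : Fin m → α => a i = x) (fun b : Fin k → β => b j = y), hsum]
    congr 1 with l
    rw [sum_filter_pi_prod_eq (fun i x => χA i x l) (fun i => hA1 i l),
      sum_filter_pi_prod_eq (fun j y => χB j y l) (fun j => hB1 j l)]
end

section
/- Existence of a joint distribution is equivalent to a local hidden variable model, for any number of parties. Precisely: let N be a natural number, for each party p : Fin N let m(p) be the number of its observables, and let Ω be a finite outcome type. Suppose given, for each choice function c ∈ Π_{p : Fin N} Fin (m p) (selecting one observable per party), a probability distribution P_c on (Fin N → Ω). Then the following are equivalent: (i) there exists a probability distribution μ on the type of total assignments ((Σ_{p : Fin N} Fin (m p)) → Ω) such that for every choice c and every ω : Fin N → Ω, the μ-probability that the observable c(p) of party p has outcome ω(p) for every p equals P_c(ω); (ii) there exist a finite type Λ, a probability distribution M on Λ, and response functions χ : (p : Fin N) → Fin (m p) → Ω → Λ → ℝ, nonnegative with ∑_{x ∈ Ω} χ p j x λ = 1 for all p, j, λ, such that P_c(ω) = ∑_{λ ∈ Λ} M(λ) · ∏_{p} χ p (c p) (ω p) λ for every choice c and every ω. -/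
/-- The weight that a product of normalized response functions gives to the assignments in which
the observable `c p` has outcome `ω p` for every `p` is the product of the weights of these
outcomes. -/
theorem sum_filter_prod_sigma_eq_prod
    {ι : Type*} [Fintype ι] [DecidableEq ι] {κ : ι → Type*} [∀ i, Fintype (κ i)]
    [∀ i, DecidableEq (κ i)] {Ω : Type*} [Fintype Ω] [DecidableEq Ω] {R : Type*} [CommSemiring R]
    (f : ∀ i, κ i → Ω → R) (hf : ∀ i j, ∑ x, f i j x = 1) (c : ∀ i, κ i) (ω : ι → Ω) :
    ∑ g ∈ Finset.univ.filter (fun g : (Σ i, κ i) → Ω => ∀ i, g ⟨i, c i⟩ = ω i),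
      ∏ s, f s.1 s.2 (g s) = ∏ i, f i (c i) (ω i) := by
  have hset : Finset.univ.filter (fun g : (Σ i, κ i) → Ω => ∀ i, g ⟨i, c i⟩ = ω i) =
      Fintype.piFinset
        (fun s : Σ i, κ i => if s.2 = c s.1 then {ω s.1} else Finset.univ) := by
    ext g
    simp only [Finset.mem_filter, Finset.mem_univ, true_and, Fintype.mem_piFinset]
    constructor
    · rintro h ⟨i, j⟩
      by_cases hj : j = c i
      · subst hj
        simp [h i]
      · simp [hj]
    · intro h i
      simpa using h ⟨i, c i⟩
  rw [hset, ← Finset.prod_univ_sum _ (fun (s : Σ i, κ i) x => f s.1 s.2 x), Fintype.prod_sigma]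
  refine Finset.prod_congr rfl fun i _ => ?_
  rw [Finset.prod_eq_single (c i)]
  · simp
  · intro j _ hj
    simp [hj, hf]
  · simp

/-- Existence of a joint distribution is equivalent to a local hidden variable
model, for any number of parties. -/
theorem joint_iff_lhv_multipartite
    (N : ℕ) (m : Fin N → ℕ)
    {Ω : Type*} [Fintype Ω] [DecidableEq Ω]
    (P : (∀ p : Fin N, Fin (m p)) → ((Fin N → Ω) → ℝ))
    (hP : ∀ c, IsProbDist (P c)) :
    (∃ μ : ((Σ p : Fin N, Fin (m p)) → Ω) → ℝ, IsProbDist μ ∧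
      ∀ (c : ∀ p : Fin N, Fin (m p)) (ω : Fin N → Ω),
        ∑ g ∈ Finset.univ.filter
            (fun g : (Σ p : Fin N, Fin (m p)) → Ω => ∀ p : Fin N, g ⟨p, c p⟩ = ω p), μ g
          = P c ω) ↔
    (∃ (Λ : Type) (instΛ : Fintype Λ) (M : Λ → ℝ)
        (χ : ∀ p : Fin N, Fin (m p) → Ω → Λ → ℝ),
      IsProbDist M ∧
      (∀ p j x l, 0 ≤ χ p j x l) ∧
      (∀ p j l, ∑ x, χ p j x l = 1) ∧
      (∀ (c : ∀ p : Fin N, Fin (m p)) (ω : Fin N → Ω),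
        P c ω = ∑ l, M l * ∏ p, χ p (c p) (ω p) l)) := by
  constructor
  · rintro ⟨μ, ⟨hμ0, hμ1⟩, hμ⟩
    let e := Fintype.equivFin ((Σ p : Fin N, Fin (m p)) → Ω)
    refine ⟨Fin (Fintype.card ((Σ p : Fin N, Fin (m p)) → Ω)), inferInstance,
      fun l => μ (e.symm l), fun p j x l => if e.symm l ⟨p, j⟩ = x then 1 else 0,
      ⟨fun l => hμ0 _, ?_⟩, ?_, ?_, ?_⟩
    · rw [← hμ1]
      exact e.symm.sum_comp μ
    · intro p j x l
      dsimp only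
      split_ifs <;> norm_num
    · intro p j l
      simp
    · intro c ω
      rw [← hμ c ω, Finset.sum_filter,
        e.symm.sum_comp (fun g => μ g * ∏ p, if g ⟨p, c p⟩ = ω p then (1 : ℝ) else 0)]
      refine Finset.sum_congr rfl fun g _ => ?_
      simp [Finset.prod_ite_zero]
  · rintro ⟨Λ, instΛ, M, χ, ⟨hM0, hM1⟩, hχ0, hχ1, hχ⟩
    refine ⟨fun g => ∑ l, M l * ∏ s : (Σ p : Fin N, Fin (m p)), χ s.1 s.2 (g s) l,
      ⟨fun g => Finset.sum_nonneg fun l _ =>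
        mul_nonneg (hM0 l) (Finset.prod_nonneg fun s _ => hχ0 _ _ _ _), ?_⟩, ?_⟩
    · rw [Finset.sum_comm, ← hM1]
      refine Finset.sum_congr rfl fun l _ => ?_
      rw [← Finset.mul_sum,
        ← Fintype.prod_sum (fun (s : Σ p : Fin N, Fin (m p)) x => χ s.1 s.2 x l)]
      simp [hχ1]
    · intro c ω
      rw [hχ, Finset.sum_comm]
      refine Finset.sum_congr rfl fun l _ => ?_
      rw [← Finset.mul_sum,
        ← sum_filter_prod_sigma_eq_prod (fun p j x => χ p j x l) (fun p j => hχ1 p j l) c ω]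
      congr!
end

section
/- A bipartite state with a symmetric m-fold extension admits a local hidden variable model for arbitrarily many observables on A and m observables on B. Precisely: let d_A, d_B, α, β be finite types, m a natural number, and ρ a density matrix on the index type d_A × (Fin m → d_B). Suppose all the bipartite reduced states ρ_{AB_j} ∈ Matrix (d_A × d_B) (d_A × d_B) ℂ, defined by ρ_{AB_j}((x,u),(y,v)) = sum of ρ((x,f),(y,g)) over all f, g : Fin m → d_B with f(j) = u, g(j) = v, and f(k) = g(k) for all k ≠ j, are equal to a common matrix ρ_{AB}. Then for every natural number K, every family of POVMs F_i : α → Matrix d_A d_A ℂ (i : Fin K), and every family of POVMs G_j : β → Matrix d_B d_B ℂ (j : Fin m), there exists a probability distribution μ on (Fin K → α) × (Fin m → β) such that for all i : Fin K, j : Fin m, x ∈ α, y ∈ β: ∑_{(a,b) with a(i) = x, b(j) = y} μ(a,b) = Re trace(ρ_{AB} · (F_i(x) ⊗ G_j(y))), where ⊗ denotes the Kronecker product on d_A × d_B. -/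
open scoped ComplexOrder Kronecker

/-- A density matrix: positive semidefinite with trace one. -/
def IsDensityMatrix {I : Type*} [Fintype I] [DecidableEq I] (ρ : Matrix I I ℂ) : Prop :=
  ρ.PosSemidef ∧ ρ.trace = 1

/-- A POVM: positive semidefinite elements summing to the identity. -/
def IsPOVM {I α : Type*} [Fintype I] [DecidableEq I] [Fintype α]
    (F : α → Matrix I I ℂ) : Prop :=
  (∀ a, (F a).PosSemidef) ∧ ∑ a, F a = 1

theorem filter_apply_eq_piFinset_update {ι β : Type*} [Fintype ι] [DecidableEq ι] [Fintype β]
    [DecidableEq β] (j : ι) (y : β) :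
    (Finset.univ.filter fun b : ι → β => b j = y)
      = Fintype.piFinset (Function.update (fun _ => Finset.univ) j ({y} : Finset β)) := by
  ext b
  simp only [Finset.mem_filter, Finset.mem_univ, true_and, Fintype.mem_piFinset]
  constructor
  · rintro h k
    by_cases hk : k = j
    · subst hk; simp [h]
    · simp [hk]
  · intro h
    simpa using h j

/-- The tensor product of a family of square matrices. -/
def tensorPi {ι d : Type*} [Fintype ι] (A : ι → Matrix d d ℂ) :
    Matrix (ι → d) (ι → d) ℂ :=
  Matrix.of fun f g => ∏ k, A k (f k) (g k)

theorem tensorPi_apply {ι d : Type*} [Fintype ι] (A : ι → Matrix d d ℂ) (f g : ι → d) :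
    tensorPi A f g = ∏ k, A k (f k) (g k) := rfl

theorem tensorPi_mul {ι d : Type*} [Fintype ι] [DecidableEq ι] [Fintype d]
    (A B : ι → Matrix d d ℂ) :
    tensorPi A * tensorPi B = tensorPi fun k => A k * B k := by
  ext f g
  simp only [Matrix.mul_apply, tensorPi_apply, ← Finset.prod_mul_distrib]
  rw [Finset.prod_univ_sum, Fintype.piFinset_univ]

theorem conjTranspose_tensorPi {ι d : Type*} [Fintype ι] (A : ι → Matrix d d ℂ) :
    (tensorPi A).conjTranspose = tensorPi fun k => (A k).conjTranspose := by
  ext f g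
  simp [tensorPi_apply, Matrix.conjTranspose_apply]

open scoped MatrixOrder in
theorem exists_eq_conjTranspose_mul_self {n : Type*} [Fintype n] [DecidableEq n]
    {P : Matrix n n ℂ} (hP : P.PosSemidef) : ∃ C : Matrix n n ℂ, P = C.conjTranspose * C :=
  CStarAlgebra.nonneg_iff_eq_star_mul_self.mp hP.nonneg

theorem tensorPi_posSemidef {ι d : Type*} [Fintype ι] [DecidableEq ι] [Fintype d]
    {A : ι → Matrix d d ℂ} (hA : ∀ k, (A k).PosSemidef) : (tensorPi A).PosSemidef := by
  classical
  choose C hC using fun k => exists_eq_conjTranspose_mul_self (hA k)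
  have h : tensorPi A = (tensorPi C).conjTranspose * tensorPi C := by
    rw [conjTranspose_tensorPi, tensorPi_mul]
    exact congrArg tensorPi (funext hC)
  rw [h]
  exact Matrix.posSemidef_conjTranspose_mul_self _

theorem tensorPi_one {ι d : Type*} [Fintype ι] [DecidableEq d] :
    tensorPi (fun _ : ι => (1 : Matrix d d ℂ)) = 1 := by
  classical
  ext f g
  simp [tensorPi_apply, Matrix.one_apply, Finset.prod_ite_zero, funext_iff]

/-- Expanding a tensor product of sums. -/
theorem sum_piFinset_tensorPi {ι d β : Type*} [Fintype ι] [DecidableEq ι]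
    (s : ι → Finset β) (G : ι → β → Matrix d d ℂ) :
    ∑ b ∈ Fintype.piFinset s, tensorPi (fun k => G k (b k))
      = tensorPi fun k => ∑ y ∈ s k, G k y := by
  ext f g
  simp only [Matrix.sum_apply, tensorPi_apply]
  rw [Finset.prod_univ_sum]

theorem sum_tensorPi_of_isPOVM {ι d β : Type*} [Fintype ι] [DecidableEq ι] [Fintype d]
    [DecidableEq d] [Fintype β] {G : ι → β → Matrix d d ℂ} (hG : ∀ k, IsPOVM (G k)) :
    ∑ b : ι → β, tensorPi (fun k => G k (b k)) = 1 := by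
  rw [← Fintype.piFinset_univ, sum_piFinset_tensorPi, ← tensorPi_one]
  exact congrArg tensorPi (funext fun k => (hG k).2)

theorem sum_filter_tensorPi_of_isPOVM {ι d β : Type*} [Fintype ι] [DecidableEq ι] [Fintype d]
    [DecidableEq d] [Fintype β] [DecidableEq β] {G : ι → β → Matrix d d ℂ}
    (hG : ∀ k, IsPOVM (G k)) (j : ι) (y : β) :
    ∑ b : ι → β with b j = y, tensorPi (fun k => G k (b k))
      = tensorPi (Function.update (fun _ => 1) j (G j y)) := by
  rw [filter_apply_eq_piFinset_update, sum_piFinset_tensorPi]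
  congr 1
  funext k
  by_cases hk : k = j
  · subst hk; simp
  · simpa [hk] using (hG k).2

theorem tensorPi_update_one_apply {ι d : Type*} [Fintype ι] [DecidableEq ι] [DecidableEq d]
    (j : ι) (M : Matrix d d ℂ) (f g : ι → d) :
    tensorPi (Function.update (fun _ => 1) j M) f g
      = if ∀ k, k ≠ j → g k = f k then M (f j) (g j) else 0 := by
  rw [tensorPi_apply, ← Finset.mul_prod_erase _ _ (Finset.mem_univ j)]
  have h : ∀ k ∈ Finset.univ.erase j,
      (Function.update (fun _ => (1 : Matrix d d ℂ)) j M) k (f k) (g k)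
        = if g k = f k then 1 else 0 := by
    intro k hk
    simp [Finset.ne_of_mem_erase hk, Matrix.one_apply, eq_comm]
  rw [Finset.prod_congr rfl h, Finset.prod_ite_zero]
  simp

theorem trace_mul_kronecker_tensorPi_update {ι dA dB : Type*} [Fintype ι] [DecidableEq ι]
    [Fintype dA] [Fintype dB] [DecidableEq dB]
    (ρ : Matrix (dA × (ι → dB)) (dA × (ι → dB)) ℂ) (ρAB : Matrix (dA × dB) (dA × dB) ℂ) (j : ι)
    (h : ∀ (x y : dA) (u v : dB), ρAB (x, u) (y, v) =
      ∑ fg ∈ Finset.univ.filter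
          (fun fg : (ι → dB) × (ι → dB) =>
            fg.1 j = u ∧ fg.2 j = v ∧ ∀ k, k ≠ j → fg.1 k = fg.2 k),
        ρ (x, fg.1) (y, fg.2))
    (M : Matrix dA dA ℂ) (N : Matrix dB dB ℂ) :
    (ρ * (M ⊗ₖ tensorPi (Function.update (fun _ => 1) j N))).trace
      = (ρAB * (M ⊗ₖ N)).trace := by
  simp only [Matrix.trace, Matrix.diag, Matrix.mul_apply, Fintype.sum_prod_type,
    Matrix.kronecker_apply, tensorPi_update_one_apply, h, Finset.sum_filter, Finset.sum_mul]
  refine Finset.sum_congr rfl fun x _ => ?_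
  symm
  calc
    _ = ∑ y : dA, ∑ f : ι → dB, ∑ g : ι → dB, ∑ u : dB, ∑ v : dB,
        (if f j = u ∧ g j = v ∧ ∀ k, k ≠ j → f k = g k then ρ (x, f) (y, g) else 0)
          * (M y x * N v u) := by
      rw [Finset.sum_comm]
      refine Finset.sum_congr rfl fun y _ => ?_
      simp only [Finset.sum_comm (s := (Finset.univ : Finset dB))
        (t := (Finset.univ : Finset (ι → dB)))]
    _ = ∑ y : dA, ∑ f : ι → dB, ∑ g : ι → dB,
        ρ (x, f) (y, g) * (M y x * if ∀ k, k ≠ j → f k = g k then N (g j) (f j) else 0) := by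
      refine Finset.sum_congr rfl fun y _ => Finset.sum_congr rfl fun f _ =>
        Finset.sum_congr rfl fun g _ => ?_
      simp [ite_and, ite_mul]
    _ = _ := Finset.sum_comm

theorem re_trace_mul_nonneg {n : Type*} [Fintype n] {P Q : Matrix n n ℂ}
    (hP : P.PosSemidef) (hQ : Q.PosSemidef) : 0 ≤ (P * Q).trace.re := by
  classical
  obtain ⟨C, rfl⟩ := exists_eq_conjTranspose_mul_self hQ
  rw [← Matrix.mul_assoc, Matrix.trace_mul_comm, ← Matrix.mul_assoc]
  exact (Complex.le_def.mp (hP.mul_mul_conjTranspose_same C).trace_nonneg).1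

theorem sum_re_trace_mul_kronecker_left {n m κ : Type*} [Fintype n] [Fintype m]
    (ρ : Matrix (n × m) (n × m) ℂ) (s : Finset κ) (M : κ → Matrix n n ℂ) (N : Matrix m m ℂ) :
    ∑ x ∈ s, (ρ * (M x ⊗ₖ N)).trace.re = (ρ * ((∑ x ∈ s, M x) ⊗ₖ N)).trace.re := by
  rw [← Complex.re_sum, ← Matrix.trace_sum, ← Matrix.mul_sum]
  congr 3
  ext r t
  simp [Matrix.sum_apply, Finset.sum_mul]

theorem sum_re_trace_mul_kronecker_right {n m κ : Type*} [Fintype n] [Fintype m]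
    (ρ : Matrix (n × m) (n × m) ℂ) (M : Matrix n n ℂ) (s : Finset κ) (N : κ → Matrix m m ℂ) :
    ∑ x ∈ s, (ρ * (M ⊗ₖ N x)).trace.re = (ρ * (M ⊗ₖ ∑ x ∈ s, N x)).trace.re := by
  rw [← Complex.re_sum, ← Matrix.trace_sum, ← Matrix.mul_sum]
  congr 3
  ext r t
  simp [Matrix.sum_apply, Finset.mul_sum]

/-- Families of subnormalised distributions `q i · b` with a common total mass `p b` are jointly
realised by making the coordinates conditionally independent given `b`. -/
theorem exists_isProbDist_of_common_marginal {ι α B : Type*} [Fintype ι] [DecidableEq ι]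
    [Fintype α] [DecidableEq α] [Fintype B] (q : ι → α → B → ℝ) (p : B → ℝ)
    (hq : ∀ i x b, 0 ≤ q i x b) (hp : ∀ b, 0 ≤ p b) (hqp : ∀ i b, ∑ x, q i x b = p b)
    (hp1 : ∑ b, p b = 1) :
    ∃ μ : (ι → α) × B → ℝ, IsProbDist μ ∧
      ∀ i x b, ∑ a : ι → α with a i = x, μ (a, b) = q i x b := by
  refine ⟨fun ab => p ab.2 * ∏ i, (q i (ab.1 i) ab.2 / p ab.2), ⟨fun ab => ?_, ?_⟩, ?_⟩
  · exact mul_nonneg (hp _) (Finset.prod_nonneg fun i _ => div_nonneg (hq _ _ _) (hp _))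
  · rw [Fintype.sum_prod_type_right, ← hp1]
    refine Finset.sum_congr rfl fun b _ => ?_
    simp only
    rw [← Finset.mul_sum, ← Fintype.piFinset_univ,
      ← Finset.prod_univ_sum (fun _ => Finset.univ) fun i x => q i x b / p b]
    by_cases hb : p b = 0
    · simp [hb]
    · simp [← Finset.sum_div, hqp, hb]
  · intro i x b
    by_cases hb : p b = 0
    · have h0 := (Finset.sum_eq_zero_iff_of_nonneg fun x _ => hq i x b).mp ((hqp i b).trans hb)
      simp [hb, h0 x (Finset.mem_univ x)]
    · simp only
      rw [← Finset.mul_sum, filter_apply_eq_piFinset_update,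
        ← Finset.prod_univ_sum _ fun i x => q i x b / p b,
        ← Finset.mul_prod_erase _ _ (Finset.mem_univ i), Finset.prod_eq_one]
      · simp only [Function.update_self, Finset.sum_singleton, mul_one]
        field_simp
      · intro k hk
        simp [Finset.ne_of_mem_erase hk, ← Finset.sum_div, hqp, hb]

/-- A bipartite state with a symmetric `m`-fold extension admits a local hidden
variable model (a joint distribution) for arbitrarily many observables on A and
`m` observables on B. -/
theorem symmetric_extension_gives_lhv
    {dA dB α β : Type*} [Fintype dA] [DecidableEq dA] [Fintype dB] [DecidableEq dB]
    [Fintype α] [DecidableEq α] [Fintype β] [DecidableEq β] (m : ℕ)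
    (ρ : Matrix (dA × (Fin m → dB)) (dA × (Fin m → dB)) ℂ) (hρ : IsDensityMatrix ρ)
    (ρAB : Matrix (dA × dB) (dA × dB) ℂ)
    (hρAB : ∀ (j : Fin m) (x y : dA) (u v : dB), ρAB (x, u) (y, v) =
      ∑ fg ∈ Finset.univ.filter
          (fun fg : (Fin m → dB) × (Fin m → dB) =>
            fg.1 j = u ∧ fg.2 j = v ∧ ∀ k, k ≠ j → fg.1 k = fg.2 k),
        ρ (x, fg.1) (y, fg.2)) :
    ∀ (K : ℕ) (F : Fin K → α → Matrix dA dA ℂ) (G : Fin m → β → Matrix dB dB ℂ),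
      (∀ i, IsPOVM (F i)) → (∀ j, IsPOVM (G j)) →
      ∃ μ : (Fin K → α) × (Fin m → β) → ℝ, IsProbDist μ ∧
        ∀ (i : Fin K) (j : Fin m) (x : α) (y : β),
          ∑ ab ∈ Finset.univ.filter
              (fun ab : (Fin K → α) × (Fin m → β) => ab.1 i = x ∧ ab.2 j = y), μ ab
            = ((ρAB * (F i x ⊗ₖ G j y)).trace).re := by
  intro K F G hF hG
  have hT (b : Fin m → β) : (tensorPi fun k => G k (b k)).PosSemidef :=
    tensorPi_posSemidef fun k => (hG k).1 _
  obtain ⟨μ, hμ, hmarg⟩ := exists_isProbDist_of_common_marginal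
    (fun i x (b : Fin m → β) => (ρ * (F i x ⊗ₖ tensorPi fun k => G k (b k))).trace.re)
    (fun b => (ρ * ((1 : Matrix dA dA ℂ) ⊗ₖ tensorPi fun k => G k (b k))).trace.re)
    (fun i x b => re_trace_mul_nonneg hρ.1 (((hF i).1 x).kronecker (hT b)))
    (fun b => re_trace_mul_nonneg hρ.1 (Matrix.PosSemidef.one.kronecker (hT b)))
    (fun i b => by rw [sum_re_trace_mul_kronecker_left, (hF i).2])
    (by rw [sum_re_trace_mul_kronecker_right, sum_tensorPi_of_isPOVM hG,
      Matrix.one_kronecker_one, mul_one, hρ.2, Complex.one_re])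
  refine ⟨μ, hμ, fun i j x y => ?_⟩
  rw [← Finset.univ_product_univ, Finset.filter_product (fun a : Fin K → α => a i = x)
    (fun b : Fin m → β => b j = y), Finset.sum_product_right]
  simp only [hmarg]
  rw [sum_re_trace_mul_kronecker_right, sum_filter_tensorPi_of_isPOVM hG,
    trace_mul_kronecker_tensorPi_update ρ ρAB j fun x y u v => by convert hρAB j x y u v]
end

section
/- A layer-permutation-symmetric multipartite state admits a local hidden variable model for m observables on each layer site and arbitrarily many observables on the single site. Precisely: let d, α, β be finite types, n ≥ 1 and m ≥ 1 natural numbers, I = (Fin (n−1) × Fin m) ⊕ Unit, and ρ a density matrix on (I → d) that is invariant under permutations within each layer (for every π : Fin (n−1) → Equiv.Perm (Fin m), ρ(f ∘ σ_π, g ∘ σ_π) = ρ(f,g) where σ_π maps (i,k) to (i, π i k) and fixes Unit). Let ρ_n ∈ Matrix ((Fin (n−1) → d) × d) ((Fin (n−1) → d) × d) ℂ be the reduced state keeping particle 0 of each layer and the Unit particle (by layer-permutation invariance this is independent of which particle per layer is kept). Then for every natural number K, every family of POVMs F^{(i)}_j : α → Matrix d d ℂ indexed by i : Fin (n−1) and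 j : Fin m, and every family of POVMs F^{(n)}_l : β → Matrix d d ℂ indexed by l : Fin K, there exists a probability distribution μ on (Fin (n−1) → (Fin m → α)) × (Fin K → β) such that for every selection k : Fin (n−1) → Fin m, every l : Fin K, every a : Fin (n−1) → α, and every y ∈ β: the marginal of μ on the events 'the k(i)-th outcome of layer site i equals a(i) for all i, and the l-th outcome on the single site equals y' equals Re trace(ρ_n · E), where E is the matrix with entries E((u,x),(v,z)) = (∏_{i} F^{(i)}_{k(i)}(a i)(u i, v i)) · F^{(n)}_l(y)(x, z). -/
open scoped ComplexOrder

/-- The permutation of the particle index set `(Fin (n-1) × Fin m) ⊕ Unit` which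
acts as `π i` within layer `i` and fixes the extra particle. -/
def layerPerm (n m : ℕ) (π : Fin (n - 1) → Equiv.Perm (Fin m)) :
    (Fin (n - 1) × Fin m) ⊕ Unit → (Fin (n - 1) × Fin m) ⊕ Unit :=
  Sum.map (fun ik => (ik.1, π ik.1 ik.2)) id

section PiKronecker

variable {d : Type*} [Fintype d] [DecidableEq d]

open scoped MatrixOrder in
theorem exists_eq_conjTranspose_mul_self_s11 {I : Type*} [Fintype I] [DecidableEq I]
    {M : Matrix I I ℂ} (hM : M.PosSemidef) : ∃ B : Matrix I I ℂ, M = B.conjTranspose * B :=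
  CStarAlgebra.nonneg_iff_eq_star_mul_self.mp hM.nonneg

/-- A tensor product of positive semidefinite matrices is positive semidefinite. -/
theorem posSemidef_pi_prod {S : Type*} [Fintype S] [DecidableEq S]
    {G : S → Matrix d d ℂ} (hG : ∀ s, (G s).PosSemidef) :
    (Matrix.of fun f g : S → d => ∏ s, G s (f s) (g s)).PosSemidef := by
  choose B hB using fun s => exists_eq_conjTranspose_mul_self_s11 (hG s)
  have h : (Matrix.of fun f g : S → d => ∏ s, G s (f s) (g s)) =
      (Matrix.of fun f g : S → d => ∏ s, B s (f s) (g s)).conjTranspose *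
        Matrix.of fun f g : S → d => ∏ s, B s (f s) (g s) := by
    ext f g
    simp only [Matrix.of_apply, Matrix.mul_apply, Matrix.conjTranspose_apply, star_prod,
      ← Finset.prod_mul_distrib]
    conv_lhs => enter [2, s]; rw [hB s]
    simp only [Matrix.mul_apply, Matrix.conjTranspose_apply, Finset.prod_univ_sum,
      Fintype.piFinset_univ]
  rw [h]
  exact Matrix.posSemidef_conjTranspose_mul_self _

/-- The trace of a product of positive semidefinite matrices has nonnegative real part. -/
theorem trace_mul_re_nonneg {I : Type*} [Fintype I] [DecidableEq I] {ρ M : Matrix I I ℂ}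
    (hρ : ρ.PosSemidef) (hM : M.PosSemidef) : 0 ≤ (ρ * M).trace.re := by
  obtain ⟨B, rfl⟩ := exists_eq_conjTranspose_mul_self_s11 hM
  rw [← Matrix.mul_assoc, Matrix.trace_mul_comm, ← Matrix.mul_assoc]
  exact (Complex.le_def.mp (hρ.mul_mul_conjTranspose_same B).trace_nonneg).1

end PiKronecker

section LayerExpectation

variable {d ι κ α : Type*} [Fintype d] [Fintype ι] [Fintype κ] [DecidableEq ι] [DecidableEq κ]

/-- The expectation in `ρ` of the product observable acting as `P i j` on particle `j` of layer `i`
and as `N` on the extra particle. -/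
noncomputable def layerExpectation (ρ : Matrix ((ι × κ) ⊕ Unit → d) ((ι × κ) ⊕ Unit → d) ℂ)
    (P : ι → κ → Matrix d d ℂ) (N : Matrix d d ℂ) : ℂ :=
  (ρ * Matrix.of fun f g : (ι × κ) ⊕ Unit → d =>
    (∏ i, ∏ j, P i j (f (Sum.inl (i, j))) (g (Sum.inl (i, j)))) *
      N (f (Sum.inr ())) (g (Sum.inr ()))).trace

theorem layerExpectation_eq_sum (ρ : Matrix ((ι × κ) ⊕ Unit → d) ((ι × κ) ⊕ Unit → d) ℂ)
    (P : ι → κ → Matrix d d ℂ) (N : Matrix d d ℂ) :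
    layerExpectation ρ P N = ∑ f, ∑ g, ρ f g *
      ((∏ i, ∏ j, P i j (g (Sum.inl (i, j))) (f (Sum.inl (i, j)))) *
        N (g (Sum.inr ())) (f (Sum.inr ()))) := by
  simp [layerExpectation, Matrix.trace, Matrix.mul_apply]

theorem layerExpectation_re_nonneg [DecidableEq d]
    {ρ : Matrix ((ι × κ) ⊕ Unit → d) ((ι × κ) ⊕ Unit → d) ℂ} (hρ : ρ.PosSemidef)
    {P : ι → κ → Matrix d d ℂ} {N : Matrix d d ℂ}
    (hP : ∀ i j, (P i j).PosSemidef) (hN : N.PosSemidef) :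
    0 ≤ (layerExpectation ρ P N).re := by
  refine trace_mul_re_nonneg hρ ?_
  have h := posSemidef_pi_prod (S := (ι × κ) ⊕ Unit)
    (G := Sum.elim (fun ij => P ij.1 ij.2) fun _ => N) (by rintro (⟨i, j⟩ | _) <;> simp [hP, hN])
  simpa [Fintype.prod_sum_type, Fintype.prod_prod_type] using h

theorem layerExpectation_one [DecidableEq d]
    (ρ : Matrix ((ι × κ) ⊕ Unit → d) ((ι × κ) ⊕ Unit → d) ℂ) :
    layerExpectation ρ (fun _ _ => 1) 1 = ρ.trace := by
  have h : (Matrix.of fun f g : (ι × κ) ⊕ Unit → d =>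
      (∏ i, ∏ j, (1 : Matrix d d ℂ) (f (Sum.inl (i, j))) (g (Sum.inl (i, j)))) *
        (1 : Matrix d d ℂ) (f (Sum.inr ())) (g (Sum.inr ()))) = 1 := by
    ext f g
    simp only [Matrix.of_apply, Matrix.one_apply, Finset.prod_ite_zero, Finset.prod_const_one,
      ← ite_and, mul_ite, mul_one, mul_zero, Finset.mem_univ, true_implies]
    refine if_congr ?_ rfl rfl
    rw [funext_iff, Sum.forall, Prod.forall, and_comm]
    exact and_congr_right fun _ => ⟨fun h _ => h, fun h => h ()⟩
  rw [layerExpectation, h, mul_one]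

theorem sum_layerExpectation_extra {β : Type*} [Fintype β]
    (ρ : Matrix ((ι × κ) ⊕ Unit → d) ((ι × κ) ⊕ Unit → d) ℂ)
    (P : ι → κ → Matrix d d ℂ) (N : β → Matrix d d ℂ) :
    ∑ y, layerExpectation ρ P (N y) = layerExpectation ρ P (∑ y, N y) := by
  simp only [layerExpectation_eq_sum, Matrix.sum_apply, Finset.mul_sum]
  rw [Finset.sum_comm]
  exact Finset.sum_congr rfl fun f _ => Finset.sum_comm

theorem sum_layerExpectation_piFinset
    (ρ : Matrix ((ι × κ) ⊕ Unit → d) ((ι × κ) ⊕ Unit → d) ℂ)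
    (F : ι → κ → α → Matrix d d ℂ) (N : Matrix d d ℂ) (s : ι → κ → Finset α) :
    ∑ A ∈ Fintype.piFinset (fun i => Fintype.piFinset (s i)),
        layerExpectation ρ (fun i j => F i j (A i j)) N =
      layerExpectation ρ (fun i j => ∑ a ∈ s i j, F i j a) N := by
  simp only [layerExpectation_eq_sum, Matrix.sum_apply, Finset.prod_univ_sum, Finset.sum_mul,
    Finset.mul_sum]
  rw [Finset.sum_comm]
  exact Finset.sum_congr rfl fun f _ => Finset.sum_comm

theorem layerExpectation_perm {ρ : Matrix ((ι × κ) ⊕ Unit → d) ((ι × κ) ⊕ Unit → d) ℂ}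
    (π : ι → Equiv.Perm κ)
    (hsym : ∀ f g : (ι × κ) ⊕ Unit → d,
      ρ (f ∘ Sum.map (fun ik => (ik.1, π ik.1 ik.2)) id)
        (g ∘ Sum.map (fun ik => (ik.1, π ik.1 ik.2)) id) = ρ f g)
    (P : ι → κ → Matrix d d ℂ) (N : Matrix d d ℂ) :
    layerExpectation ρ (fun i j => P i (π i j)) N = layerExpectation ρ P N := by
  let e : (ι × κ) ⊕ Unit ≃ (ι × κ) ⊕ Unit :=
    Equiv.sumCongr ⟨fun x => (x.1, π x.1 x.2), fun x => (x.1, (π x.1).symm x.2),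
      fun x => by simp, fun x => by simp⟩ (Equiv.refl Unit)
  have he : (e : (ι × κ) ⊕ Unit → (ι × κ) ⊕ Unit) =
      Sum.map (fun ik => (ik.1, π ik.1 ik.2)) id := by
    ext x; rcases x with x | x <;> rfl
  rw [← he] at hsym
  let E : ((ι × κ) ⊕ Unit → d) ≃ ((ι × κ) ⊕ Unit → d) := Equiv.arrowCongr e.symm (Equiv.refl d)
  have hE : ∀ f, E f = f ∘ e := fun f => rfl
  rw [layerExpectation_eq_sum, layerExpectation_eq_sum, ← E.sum_comp]
  refine Finset.sum_congr rfl fun f _ => ?_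
  rw [← E.sum_comp]
  refine Finset.sum_congr rfl fun g _ => ?_
  rw [hE, hE, hsym]
  congr 2
  refine Finset.prod_congr rfl fun i _ => ?_
  exact Equiv.prod_comp (π i) fun j => P i j (g (Sum.inl (i, j))) (f (Sum.inl (i, j)))

/-- Observables acting on one particle per layer have the same expectation in the reduced state. -/
theorem layerExpectation_single [DecidableEq d]
    (ρ : Matrix ((ι × κ) ⊕ Unit → d) ((ι × κ) ⊕ Unit → d) ℂ) (z : κ)
    (ρ' : Matrix ((ι → d) × d) ((ι → d) × d) ℂ)
    (hρ' : ∀ (u v : ι → d) (x y : d),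
      ρ' (u, x) (v, y) =
        ∑ fg ∈ Finset.univ.filter
            (fun fg : ((ι × κ) ⊕ Unit → d) × ((ι × κ) ⊕ Unit → d) =>
              (∀ i, fg.1 (Sum.inl (i, z)) = u i) ∧
              (∀ i, fg.2 (Sum.inl (i, z)) = v i) ∧
              fg.1 (Sum.inr ()) = x ∧ fg.2 (Sum.inr ()) = y ∧
              (∀ i (l : κ), l ≠ z →
                fg.1 (Sum.inl (i, l)) = fg.2 (Sum.inl (i, l)))),
          ρ fg.1 fg.2)
    (Q : ι → Matrix d d ℂ) (N : Matrix d d ℂ) :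
    layerExpectation ρ (fun i j => if j = z then Q i else 1) N =
      (ρ' * Matrix.of fun ux vy : (ι → d) × d =>
        (∏ i, Q i (ux.1 i) (vy.1 i)) * N ux.2 vy.2).trace := by
  have hprod : ∀ f g : (ι × κ) ⊕ Unit → d,
      (∏ i, ∏ j, (if j = z then Q i else 1) (g (Sum.inl (i, j))) (f (Sum.inl (i, j)))) =
        if ∀ i, ∀ l : κ, l ≠ z → f (Sum.inl (i, l)) = g (Sum.inl (i, l)) then
          ∏ i, Q i (g (Sum.inl (i, z))) (f (Sum.inl (i, z))) else 0 := by
    intro f g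
    have hrow : ∀ i, ∏ j, (if j = z then Q i else 1) (g (Sum.inl (i, j))) (f (Sum.inl (i, j))) =
        if ∀ l : κ, l ≠ z → f (Sum.inl (i, l)) = g (Sum.inl (i, l)) then
          Q i (g (Sum.inl (i, z))) (f (Sum.inl (i, z))) else 0 := by
      intro i
      rw [← Finset.mul_prod_erase _ _ (Finset.mem_univ z), if_pos rfl]
      have : ∏ j ∈ Finset.univ.erase z,
          (if j = z then Q i else 1) (g (Sum.inl (i, j))) (f (Sum.inl (i, j))) =
          ∏ j ∈ Finset.univ.erase z,
            if f (Sum.inl (i, j)) = g (Sum.inl (i, j)) then (1 : ℂ) else 0 := by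
        refine Finset.prod_congr rfl fun j hj => ?_
        rw [if_neg (Finset.ne_of_mem_erase hj), Matrix.one_apply]
        simp only [eq_comm]
      rw [this, Finset.prod_ite_zero]
      simp
    simp only [hrow, Finset.prod_ite_zero, Finset.mem_univ, true_implies]
  rw [layerExpectation_eq_sum, ← Fintype.sum_prod_type'
    (f := fun f g : (ι × κ) ⊕ Unit → d => ρ f g *
      ((∏ i, ∏ j, (if j = z then Q i else 1) (g (Sum.inl (i, j))) (f (Sum.inl (i, j)))) *
        N (g (Sum.inr ())) (f (Sum.inr ()))))]
  simp only [Matrix.trace, Matrix.diag, Matrix.mul_apply, Matrix.of_apply]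
  rw [← Fintype.sum_prod_type' (f := fun p q : (ι → d) × d => ρ' p q *
      ((∏ i, Q i (q.1 i) (p.1 i)) * N q.2 p.2))]
  have hρ'' : ∀ p : ((ι → d) × d) × ((ι → d) × d), ρ' p.1 p.2 =
      ∑ fg : ((ι × κ) ⊕ Unit → d) × ((ι × κ) ⊕ Unit → d),
        if p = ((fun i => fg.1 (Sum.inl (i, z)), fg.1 (Sum.inr ())),
            (fun i => fg.2 (Sum.inl (i, z)), fg.2 (Sum.inr ()))) then
          if ∀ i, ∀ l : κ, l ≠ z → fg.1 (Sum.inl (i, l)) = fg.2 (Sum.inl (i, l)) then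
            ρ fg.1 fg.2 else 0 else 0 := by
    rintro ⟨⟨u, x⟩, v, y⟩
    rw [hρ', Finset.sum_filter]
    refine Finset.sum_congr rfl fun fg _ => ?_
    rw [← ite_and]
    refine if_congr ?_ rfl rfl
    simp only [Prod.mk.injEq, funext_iff, eq_comm]
    tauto
  simp only [hρ'', Finset.sum_mul]
  rw [Finset.sum_comm]
  refine Finset.sum_congr rfl fun fg _ => ?_
  simp only [ite_mul, zero_mul, Finset.sum_ite_eq', Finset.mem_univ, if_true,
    hprod, mul_ite, mul_zero]

end LayerExpectation

/-- Families of weights with a common total mass `w x` are the marginals of a joint weight. -/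
theorem exists_joint_weight {X β : Type*} [Fintype β] [DecidableEq β] {K : ℕ}
    (w : X → ℝ) (q : X → Fin K → β → ℝ) (hw : ∀ x, 0 ≤ w x) (hq : ∀ x l y, 0 ≤ q x l y)
    (hsum : ∀ x l, ∑ y, q x l y = w x) :
    ∃ μ : X × (Fin K → β) → ℝ, (∀ z, 0 ≤ μ z) ∧ (∀ x, ∑ b, μ (x, b) = w x) ∧
      ∀ x l y, ∑ b with b l = y, μ (x, b) = q x l y := by
  refine ⟨fun z => w z.1 * ∏ l, (q z.1 l (z.2 l) / w z.1), fun z => ?_, fun x => ?_,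
    fun x l y => ?_⟩
  · exact mul_nonneg (hw _) (Finset.prod_nonneg fun l _ => div_nonneg (hq _ _ _) (hw _))
  · rcases eq_or_ne (w x) 0 with h | h
    · simp [h]
    · dsimp only
      rw [← Finset.mul_sum]
      have := Finset.prod_univ_sum (fun _ : Fin K => (Finset.univ : Finset β))
        fun l y => q x l y / w x
      rw [Fintype.piFinset_univ] at this
      rw [← this]
      simp [← Finset.sum_div, hsum, h]
  · rcases eq_or_ne (w x) 0 with h | h
    · have h0 : q x l y = 0 := (Finset.sum_eq_zero_iff_of_nonneg fun y _ => hq x l y).mp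
        ((hsum x l).trans h) y (Finset.mem_univ y)
      simp [h, h0]
    · have hset : (Finset.univ.filter fun b : Fin K → β => b l = y) =
          Fintype.piFinset fun l' => if l' = l then {y} else Finset.univ := by
        ext b
        simp only [Finset.mem_filter, Finset.mem_univ, true_and, Fintype.mem_piFinset]
        refine ⟨fun hb l' => ?_, fun hb => by simpa using hb l⟩
        split_ifs with h'
        · simp [h', hb]
        · simp
      dsimp only
      rw [← Finset.mul_sum, hset,
        ← Finset.prod_univ_sum (fun l' => if l' = l then {y} else Finset.univ)
          fun l y => q x l y / w x,
        ← Finset.mul_prod_erase _ _ (Finset.mem_univ l), Finset.prod_eq_one]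
      · simp [mul_div_cancel₀ _ h]
      · intro l' hl'
        rw [if_neg (Finset.ne_of_mem_erase hl'), ← Finset.sum_div, hsum, div_self h]

/-- A layer-permutation-symmetric multipartite state admits a local hidden variable
model (a joint distribution) for `m` observables on each layer site and arbitrarily
many observables on the single site. -/
theorem layer_symmetric_gives_lhv
    {d α β : Type*} [Fintype d] [DecidableEq d]
    [Fintype α] [DecidableEq α] [Fintype β] [DecidableEq β]
    (n m : ℕ) (hn : 1 ≤ n) (hm : 1 ≤ m)
    (ρ : Matrix (((Fin (n - 1) × Fin m) ⊕ Unit) → d)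
                (((Fin (n - 1) × Fin m) ⊕ Unit) → d) ℂ)
    (hρ : IsDensityMatrix ρ)
    (hsym : ∀ (π : Fin (n - 1) → Equiv.Perm (Fin m))
        (f g : ((Fin (n - 1) × Fin m) ⊕ Unit) → d),
      ρ (f ∘ layerPerm n m π) (g ∘ layerPerm n m π) = ρ f g)
    (ρn : Matrix ((Fin (n - 1) → d) × d) ((Fin (n - 1) → d) × d) ℂ)
    (hρn : ∀ (u v : Fin (n - 1) → d) (x y : d),
      ρn (u, x) (v, y) =
        ∑ fg ∈ Finset.univ.filter
            (fun fg : (((Fin (n - 1) × Fin m) ⊕ Unit) → d) ×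
                      (((Fin (n - 1) × Fin m) ⊕ Unit) → d) =>
              (∀ i, fg.1 (Sum.inl (i, ⟨0, hm⟩)) = u i) ∧
              (∀ i, fg.2 (Sum.inl (i, ⟨0, hm⟩)) = v i) ∧
              fg.1 (Sum.inr ()) = x ∧ fg.2 (Sum.inr ()) = y ∧
              (∀ i (l : Fin m), l ≠ ⟨0, hm⟩ →
                fg.1 (Sum.inl (i, l)) = fg.2 (Sum.inl (i, l)))),
          ρ fg.1 fg.2) :
    ∀ (K : ℕ) (F : Fin (n - 1) → Fin m → α → Matrix d d ℂ)
      (Fn : Fin K → β → Matrix d d ℂ),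
      (∀ i j, IsPOVM (F i j)) → (∀ l, IsPOVM (Fn l)) →
      ∃ μ : (Fin (n - 1) → Fin m → α) × (Fin K → β) → ℝ, IsProbDist μ ∧
        ∀ (k : Fin (n - 1) → Fin m) (l : Fin K) (a : Fin (n - 1) → α) (y : β),
          ∑ Ab ∈ Finset.univ.filter
              (fun Ab : (Fin (n - 1) → Fin m → α) × (Fin K → β) =>
                (∀ i, Ab.1 i (k i) = a i) ∧ Ab.2 l = y), μ Ab
            = ((ρn * Matrix.of
                (fun ux vz : (Fin (n - 1) → d) × d =>
                  (∏ i, F i (k i) (a i) (ux.1 i) (vz.1 i)) *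
                    Fn l y ux.2 vz.2)).trace).re := by
  intro K F Fn hF hFn
  obtain ⟨μ, hμ0, hμw, hμq⟩ := exists_joint_weight (K := K)
    (fun A : Fin (n - 1) → Fin m → α => (layerExpectation ρ (fun i j => F i j (A i j)) 1).re)
    (fun A l y => (layerExpectation ρ (fun i j => F i j (A i j)) (Fn l y)).re)
    (fun A => layerExpectation_re_nonneg hρ.1 (fun i j => (hF i j).1 _) Matrix.PosSemidef.one)
    (fun A l y => layerExpectation_re_nonneg hρ.1 (fun i j => (hF i j).1 _) ((hFn l).1 y))
    (fun A l => by rw [← Complex.re_sum, sum_layerExpectation_extra, (hFn l).2])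
  refine ⟨μ, ⟨hμ0, ?_⟩, fun k l a y => ?_⟩
  · have h := sum_layerExpectation_piFinset ρ F 1 fun _ _ => Finset.univ
    simp only [Fintype.piFinset_univ, (hF _ _).2, layerExpectation_one, hρ.2] at h
    rw [Fintype.sum_prod_type]
    simp only [hμw]
    rw [← Complex.re_sum, h, Complex.one_re]
  · let s : Fin (n - 1) → Fin m → Finset α := fun i j => if j = k i then {a i} else Finset.univ
    have hset : (Finset.univ.filter fun Ab : (Fin (n - 1) → Fin m → α) × (Fin K → β) =>
        (∀ i, Ab.1 i (k i) = a i) ∧ Ab.2 l = y) =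
        (Fintype.piFinset fun i => Fintype.piFinset (s i)) ×ˢ
          Finset.univ.filter fun b => b l = y := by
      ext ⟨A, b⟩
      simp only [Finset.mem_filter, Finset.mem_univ, true_and, Finset.mem_product,
        Fintype.mem_piFinset, and_congr_left_iff]
      refine fun _ => forall_congr' fun i => ⟨fun h j => ?_, fun h => by simpa [s] using h (k i)⟩
      by_cases hj : j = k i
      · simp [s, hj, h]
      · simp [s, hj]
    have hs : (fun i j => ∑ c ∈ s i j, F i j c) =
        fun i j => (fun i j => if j = ⟨0, hm⟩ then F i (k i) (a i) else 1) i
          (Equiv.swap (k i) ⟨0, hm⟩ j) := by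
      funext i j
      by_cases hj : j = k i
      · simp [s, hj]
      · simp [s, hj, (hF i j).2, Equiv.swap_apply_eq_iff]
    rw [hset, Finset.sum_product]
    simp only [hμq]
    rw [← Complex.re_sum, sum_layerExpectation_piFinset, hs,
      layerExpectation_perm (fun i => Equiv.swap (k i) ⟨0, hm⟩)
        (hsym fun i => Equiv.swap (k i) ⟨0, hm⟩)
        fun i j => if j = ⟨0, hm⟩ then F i (k i) (a i) else 1,
      layerExpectation_single ρ ⟨0, hm⟩ ρn fun u v x y => by convert hρn u v x y]
end

section
/- The maximum of a linear entanglement functional on two sites, over all globally symmetric states, equals the largest eigenvalue of the group-averaged two-site operator and is attained. Precisely: let n ≥ 2 and d ≥ 1 be natural numbers, G a subgroup of Equiv.Perm (Fin n), and for g ∈ G let U_g be the unitary on Matrix (Fin n → Fin d) (Fin n → Fin d) ℂ permuting the tensor factors of (ℂ^d)^{⊗n}, i.e. (U_g)(f, f') = 1 if f = f' ∘ g⁻¹ and 0 otherwise. Let K ∈ Matrix ((Fin d) × (Fin d)) ((Fin d) × (Fin d)) ℂ be Hermitian, and let K⊗1 be the matrix on (Fin n → Fin d) with entries (K⊗1)(f,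 f') = K((f 0, f 1), (f' 0, f' 1)) if f(k) = f'(k) for all k ≥ 2, and 0 otherwise. For a density matrix ρ on (Fin n → Fin d), let ρ_{01} be its two-site reduced state on (Fin d) × (Fin d): ρ_{01}((x,y),(x',y')) = sum of ρ(f, f') over f, f' with f(0)=x, f(1)=y, f'(0)=x', f'(1)=y', and f(k)=f'(k) for all k ≥ 2. Then the supremum, over all density matrices ρ on (Fin n → Fin d) which are G-invariant (U_g ρ U_g† = ρ for all g ∈ G), of Re trace(ρ_{01} · K) equals the largest eigenvalue of the Hermitian matrix H := (1/|G|) ∑_{g ∈ G} U_g (K⊗1) U_g†; moreover this supremum is attained by some G-invariant density matrix. -/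
open Matrix
open scoped ComplexOrder

/-- The unitary permuting the `n` tensor factors of `(ℂ^d)^{⊗n}` according to `g`. -/
def permMatrix (n d : ℕ) (g : Equiv.Perm (Fin n)) :
    Matrix (Fin n → Fin d) (Fin n → Fin d) ℂ :=
  Matrix.of fun f f' => if f = f' ∘ ⇑g⁻¹ then 1 else 0

/-- The operator `K ⊗ 1`, acting as `K` on the first two sites and trivially on the rest. -/
def twoSiteObs (n d : ℕ) (hn : 2 ≤ n)
    (K : Matrix (Fin d × Fin d) (Fin d × Fin d) ℂ) :
    Matrix (Fin n → Fin d) (Fin n → Fin d) ℂ :=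
  Matrix.of fun f f' =>
    if ∀ k : Fin n, 2 ≤ (k : ℕ) → f k = f' k then
      K (f ⟨0, by omega⟩, f ⟨1, by omega⟩) (f' ⟨0, by omega⟩, f' ⟨1, by omega⟩)
    else 0

/-- The two-site reduced state on sites `0` and `1`. -/
noncomputable def twoSiteReduced (n d : ℕ) (hn : 2 ≤ n)
    (ρ : Matrix (Fin n → Fin d) (Fin n → Fin d) ℂ) :
    Matrix (Fin d × Fin d) (Fin d × Fin d) ℂ :=
  Matrix.of fun xy x'y' =>
    ∑ ff' ∈ Finset.univ.filter
        (fun ff' : (Fin n → Fin d) × (Fin n → Fin d) =>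
          ff'.1 ⟨0, by omega⟩ = xy.1 ∧ ff'.1 ⟨1, by omega⟩ = xy.2 ∧
          ff'.2 ⟨0, by omega⟩ = x'y'.1 ∧ ff'.2 ⟨1, by omega⟩ = x'y'.2 ∧
          ∀ k : Fin n, 2 ≤ (k : ℕ) → ff'.1 k = ff'.2 k),
      ρ ff'.1 ff'.2

/-- The group average `(1/|G|) ∑_{g ∈ G} U_g (K ⊗ 1) U_g†`. -/
noncomputable def avgHam (n d : ℕ) (hn : 2 ≤ n)
    (G : Subgroup (Equiv.Perm (Fin n))) [Fintype G]
    (K : Matrix (Fin d × Fin d) (Fin d × Fin d) ℂ) :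
    Matrix (Fin n → Fin d) (Fin n → Fin d) ℂ :=
  ((Fintype.card G : ℂ))⁻¹ •
    ∑ g : G, permMatrix n d g * twoSiteObs n d hn K * (permMatrix n d g)ᴴ

theorem permMatrix_mul (n d : ℕ) (g h : Equiv.Perm (Fin n)) :
    permMatrix n d g * permMatrix n d h = permMatrix n d (g * h) := by
  ext f f'
  simp only [permMatrix, Matrix.mul_apply, Matrix.of_apply]
  rw [Finset.sum_eq_single (f' ∘ ⇑h⁻¹)]
  · simp [Function.comp_assoc, _root_.mul_inv_rev, Equiv.Perm.coe_mul]
  · intro b _ hb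
    rw [if_neg hb, mul_zero]
  · simp

theorem permMatrix_one (n d : ℕ) : permMatrix n d 1 = 1 := by
  ext f f'
  simp [permMatrix, Matrix.one_apply]

theorem conjTranspose_permMatrix (n d : ℕ) (g : Equiv.Perm (Fin n)) :
    (permMatrix n d g)ᴴ = permMatrix n d g⁻¹ := by
  ext f f'
  have key : f' = f ∘ ⇑g⁻¹ ↔ f = f' ∘ ⇑(g⁻¹)⁻¹ := by
    constructor <;> rintro rfl <;> funext x <;> simp
  simp only [permMatrix, Matrix.conjTranspose_apply, Matrix.of_apply, key]
  split_ifs <;> simp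

/-- The average of `A` under conjugation by the factor permutations in `G`. -/
noncomputable def groupTwirl (n d : ℕ) (G : Subgroup (Equiv.Perm (Fin n))) [Fintype G]
    (A : Matrix (Fin n → Fin d) (Fin n → Fin d) ℂ) :
    Matrix (Fin n → Fin d) (Fin n → Fin d) ℂ :=
  ((Fintype.card G : ℂ))⁻¹ •
    ∑ g : G, permMatrix n d g * A * (permMatrix n d g)ᴴ

section groupTwirl

variable {n d : ℕ} {G : Subgroup (Equiv.Perm (Fin n))} [Fintype G]
  {A : Matrix (Fin n → Fin d) (Fin n → Fin d) ℂ}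

theorem groupTwirl_isHermitian (hA : A.IsHermitian) : (groupTwirl n d G A).IsHermitian := by
  simp only [groupTwirl, Matrix.IsHermitian, Matrix.conjTranspose_smul, Matrix.conjTranspose_sum,
    Matrix.conjTranspose_mul, Matrix.conjTranspose_conjTranspose, hA.eq, Matrix.mul_assoc]
  simp

theorem groupTwirl_posSemidef (hA : A.PosSemidef) : (groupTwirl n d G A).PosSemidef := by
  refine Matrix.PosSemidef.smul (Matrix.posSemidef_sum _ fun g _ =>
    hA.mul_mul_conjTranspose_same _) ?_
  exact inv_nonneg.mpr (Nat.cast_nonneg _)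

theorem permMatrix_conj_groupTwirl (g : Equiv.Perm (Fin n)) (hg : g ∈ G) :
    permMatrix n d g * groupTwirl n d G A * (permMatrix n d g)ᴴ = groupTwirl n d G A := by
  simp only [groupTwirl, Matrix.mul_smul, Matrix.smul_mul, Matrix.mul_sum, Matrix.sum_mul]
  refine congrArg _ ?_
  rw [← Equiv.sum_comp (Equiv.mulLeft (⟨g, hg⟩ : G))
    fun h : G => permMatrix n d h * A * (permMatrix n d h)ᴴ]
  refine Finset.sum_congr rfl fun h _ => ?_
  simp only [Equiv.coe_mulLeft, Subgroup.coe_mul, ← permMatrix_mul, Matrix.conjTranspose_mul,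
    Matrix.mul_assoc]

theorem groupTwirl_eq_self
    (hA : ∀ g ∈ G, permMatrix n d g * A * (permMatrix n d g)ᴴ = A) :
    groupTwirl n d G A = A := by
  have h (g : G) : permMatrix n d g * A * (permMatrix n d g)ᴴ = A := hA g g.property
  simp only [groupTwirl, h]
  rw [Finset.sum_const, Finset.card_univ,
    ← Nat.cast_smul_eq_nsmul ℂ, inv_smul_smul₀ (Nat.cast_ne_zero.mpr Fintype.card_ne_zero)]

theorem trace_groupTwirl_mul (A B : Matrix (Fin n → Fin d) (Fin n → Fin d) ℂ) :
    (groupTwirl n d G A * B).trace = (A * groupTwirl n d G B).trace := by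
  simp only [groupTwirl, Matrix.mul_smul, Matrix.smul_mul, Matrix.mul_sum, Matrix.sum_mul,
    Matrix.trace_smul, Matrix.trace_sum]
  congr 1
  refine Fintype.sum_equiv (Equiv.inv G) _ _ fun g => ?_
  simp only [Equiv.inv_apply, Subgroup.coe_inv, conjTranspose_permMatrix, inv_inv]
  rw [Matrix.mul_assoc, Matrix.mul_assoc, Matrix.trace_mul_comm]
  simp only [Matrix.mul_assoc]

theorem trace_groupTwirl (A : Matrix (Fin n → Fin d) (Fin n → Fin d) ℂ) :
    (groupTwirl n d G A).trace = A.trace := by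
  have h1 : groupTwirl n d G (1 : Matrix (Fin n → Fin d) (Fin n → Fin d) ℂ) = 1 :=
    groupTwirl_eq_self fun g _ => by
      rw [Matrix.mul_one, conjTranspose_permMatrix, permMatrix_mul, mul_inv_cancel, permMatrix_one]
  simpa [h1] using trace_groupTwirl_mul (G := G) A 1

end groupTwirl

theorem twoSiteObs_isHermitian {n d : ℕ} (hn : 2 ≤ n)
    {K : Matrix (Fin d × Fin d) (Fin d × Fin d) ℂ} (hK : K.IsHermitian) :
    (twoSiteObs n d hn K).IsHermitian := by
  ext f f'
  simp only [twoSiteObs, Matrix.conjTranspose_apply, Matrix.of_apply, @eq_comm _ (f' _)]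
  split_ifs
  · exact hK.apply _ _
  · simp

theorem trace_twoSiteReduced_mul {n d : ℕ} (hn : 2 ≤ n)
    (ρ : Matrix (Fin n → Fin d) (Fin n → Fin d) ℂ)
    (K : Matrix (Fin d × Fin d) (Fin d × Fin d) ℂ) :
    (twoSiteReduced n d hn ρ * K).trace = (ρ * twoSiteObs n d hn K).trace := by
  simp only [Matrix.trace, Matrix.diag_apply, Matrix.mul_apply, twoSiteReduced, twoSiteObs,
    Matrix.of_apply, Finset.sum_mul, Finset.sum_filter]
  simp only [← Fintype.sum_prod_type' (f := fun (_ _ : Fin d × Fin d) => _)]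
  simp only [← Fintype.sum_prod_type' (f := fun (_ _ : Fin n → Fin d) => _)]
  rw [Finset.sum_comm]
  refine Finset.sum_congr rfl fun ff' _ => ?_
  rw [Finset.sum_eq_single
    ((ff'.1 ⟨0, by omega⟩, ff'.1 ⟨1, by omega⟩), (ff'.2 ⟨0, by omega⟩, ff'.2 ⟨1, by omega⟩))]
  · simp [@eq_comm _ (ff'.2 _)]
  · rintro ⟨⟨a, b⟩, c, e⟩ _ hne
    rw [if_neg, zero_mul]
    rintro ⟨rfl, rfl, rfl, rfl, -⟩
    exact hne rfl
  · simp

section eigenvalues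

variable {I : Type*} [Fintype I] [DecidableEq I]

theorem Matrix.PosSemidef.trace_mul_nonneg {A B : Matrix I I ℂ} (hA : A.PosSemidef)
    (hB : B.PosSemidef) : 0 ≤ (A * B).trace := by
  open scoped MatrixOrder in
  obtain ⟨C, rfl⟩ := CStarAlgebra.nonneg_iff_eq_star_mul_self.mp hA.nonneg
  rw [Matrix.mul_assoc, Matrix.trace_mul_comm]
  exact (hB.mul_mul_conjTranspose_same C).trace_nonneg

theorem Matrix.IsHermitian.posSemidef_smul_one_sub {H : Matrix I I ℂ} (hH : H.IsHermitian)
    {c : ℝ} (hc : ∀ i, hH.eigenvalues i ≤ c) : ((c : ℂ) • (1 : Matrix I I ℂ) - H).PosSemidef := by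
  let V : Matrix I I ℂ := hH.eigenvectorUnitary
  have hV : V * Vᴴ = 1 := Unitary.mul_star_self_of_mem hH.eigenvectorUnitary.2
  have hspec : H = V * Matrix.diagonal (fun i => (hH.eigenvalues i : ℂ)) * Vᴴ := hH.spectral_theorem
  have hdiag : (Matrix.diagonal fun i => ((c : ℂ) - (hH.eigenvalues i : ℂ))).PosSemidef :=
    Matrix.PosSemidef.diagonal fun i => by
      simpa [← Complex.ofReal_sub] using hc i
  have heq : (c : ℂ) • (1 : Matrix I I ℂ) - H =
      V * Matrix.diagonal (fun i => ((c : ℂ) - (hH.eigenvalues i : ℂ))) * Vᴴ := by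
    rw [← Matrix.diagonal_sub, Matrix.mul_sub, Matrix.sub_mul, ← hspec,
      ← Matrix.smul_one_eq_diagonal,
      Matrix.mul_smul, Matrix.smul_mul, Matrix.mul_one, hV]
  rw [heq]
  exact hdiag.mul_mul_conjTranspose_same V

theorem IsDensityMatrix.re_trace_mul_le {ρ H : Matrix I I ℂ} (hρ : IsDensityMatrix ρ)
    (hH : H.IsHermitian) {c : ℝ} (hc : ∀ i, hH.eigenvalues i ≤ c) : (ρ * H).trace.re ≤ c := by
  have h := hρ.1.trace_mul_nonneg (hH.posSemidef_smul_one_sub hc)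
  rw [Matrix.mul_sub, Matrix.trace_sub, Matrix.mul_smul, Matrix.mul_one, Matrix.trace_smul,
    hρ.2] at h
  simpa using (Complex.le_def.mp h).1

theorem Matrix.IsHermitian.exists_isDensityMatrix_trace_mul_eq {H : Matrix I I ℂ}
    (hH : H.IsHermitian) (i : I) :
    ∃ ρ : Matrix I I ℂ, IsDensityMatrix ρ ∧ (ρ * H).trace = hH.eigenvalues i := by
  let v : I → ℂ := hH.eigenvectorBasis i
  have hv : v ⬝ᵥ star v = 1 := by
    have h := hH.eigenvectorBasis.inner_eq_one i
    rwa [EuclideanSpace.inner_eq_star_dotProduct] at h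
  refine ⟨Matrix.vecMulVec v (star v), ⟨Matrix.posSemidef_vecMulVec_self_star v, ?_⟩, ?_⟩
  · rw [Matrix.trace_vecMulVec, hv]
  · have h : H *ᵥ v = hH.eigenvalues i • v := hH.mulVec_eigenvectorBasis i
    rw [Matrix.trace_mul_comm, Matrix.mul_vecMulVec, Matrix.trace_vecMulVec, h, smul_dotProduct, hv]
    simp

end eigenvalues

/-- The maximum of a linear entanglement functional on two sites, over all globally
symmetric states, equals the largest eigenvalue of the group-averaged two-site
operator and is attained. -/
theorem max_linear_functional_eq_max_eigenvalue
    (n d : ℕ) (hn : 2 ≤ n) (hd : 1 ≤ d)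
    (G : Subgroup (Equiv.Perm (Fin n))) [Fintype G]
    (K : Matrix (Fin d × Fin d) (Fin d × Fin d) ℂ) (hK : K.IsHermitian) :
    ∃ hH : (avgHam n d hn G K).IsHermitian,
      IsGreatest
        {x : ℝ | ∃ ρ : Matrix (Fin n → Fin d) (Fin n → Fin d) ℂ,
          IsDensityMatrix ρ ∧
          (∀ g ∈ G, permMatrix n d g * ρ * (permMatrix n d g)ᴴ = ρ) ∧
          x = ((twoSiteReduced n d hn ρ * K).trace).re}
        (⨆ i, hH.eigenvalues i) := by
  have hH : (groupTwirl n d G (twoSiteObs n d hn K)).IsHermitian :=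
    groupTwirl_isHermitian (twoSiteObs_isHermitian hn hK)
  have : NeZero d := ⟨by omega⟩
  refine ⟨hH, ?_, ?_⟩
  · obtain ⟨i, hi⟩ := exists_eq_ciSup_of_finite (f := hH.eigenvalues)
    obtain ⟨ρ, hρ, htr⟩ := hH.exists_isDensityMatrix_trace_mul_eq i
    refine ⟨groupTwirl n d G ρ, ⟨groupTwirl_posSemidef hρ.1, ?_⟩,
      fun g hg => permMatrix_conj_groupTwirl g hg, ?_⟩
    · rw [trace_groupTwirl, hρ.2]
    · rw [trace_twoSiteReduced_mul, trace_groupTwirl_mul, htr, Complex.ofReal_re, hi]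
      rfl
  · rintro x ⟨ρ, hρ, hinv, rfl⟩
    rw [trace_twoSiteReduced_mul, ← groupTwirl_eq_self hinv, trace_groupTwirl_mul]
    exact hρ.re_trace_mul_le hH fun i => le_ciSup (Set.finite_range hH.eigenvalues).bddAbove i
end

section
/- The entanglement of formation equals the supremum of the affine functionals lying below the reduced-state entropy. Precisely: let A, B be finite types and ρ a density matrix on A × B. Define E_F(ρ) as the infimum, over all finite families (p_i, ψ_i)_{i ∈ Fin N} with p_i > 0, ∑_i p_i = 1, ψ_i unit vectors in ℂ^{A×B}, and ∑_i p_i |ψ_i⟩⟨ψ_i| = ρ, of ∑_i p_i S(tr_A(|ψ_i⟩⟨ψ_i|)). Then E_F(ρ) = sup { Re trace(ρ · h) : h ∈ Matrix (A × B) (A × B) ℂ Hermitian, such that Re trace(σ · h) ≤ S(tr_A(σ)) for every density matrix σ on A × B }. -/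
open Matrix
open scoped ComplexOrder

/-- The partial trace over the first tensor factor. -/
noncomputable def ptraceA {A B : Type*} [Fintype A] (σ : Matrix (A × B) (A × B) ℂ) :
    Matrix B B ℂ :=
  Matrix.of fun b b' => ∑ a, σ (a, b) (a, b')

/-- The von Neumann entropy `S(σ) = ∑ᵢ -λᵢ log λᵢ` of a (Hermitian) matrix. -/
noncomputable def vonNeumannEntropy {I : Type*} [Fintype I] [DecidableEq I]
    (σ : Matrix I I ℂ) : ℝ :=
  if h : σ.IsHermitian then ∑ i, Real.negMulLog (h.eigenvalues i) else 0

/-- The rank-one projector `|ψ⟩⟨ψ|`. -/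
def outer {I : Type*} (ψ : I → ℂ) : Matrix I I ℂ :=
  Matrix.of fun i j => ψ i * (starRingEnd ℂ) (ψ j)

/-- Values of `∑ pᵢ S(tr_A |ψᵢ⟩⟨ψᵢ|)` over pure-state decompositions of `ρ`. -/
noncomputable def pureDecompVals {A B : Type*} [Fintype A] [Fintype B]
    [DecidableEq A] [DecidableEq B] (ρ : Matrix (A × B) (A × B) ℂ) : Set ℝ :=
  {x | ∃ (N : ℕ) (p : Fin N → ℝ) (ψ : Fin N → (A × B → ℂ)),
    (∀ i, 0 < p i) ∧ (∑ i, p i = 1) ∧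
    (∀ i, ∑ z, Complex.normSq (ψ i z) = 1) ∧
    (∑ i, (p i : ℂ) • outer (ψ i)) = ρ ∧
    x = ∑ i, p i * vonNeumannEntropy (ptraceA (outer (ψ i)))}

/-- The convex hull of a compact set in a finite-dimensional space is compact. -/
theorem IsCompact.convexHull_of_finiteDimensional {E : Type*} [AddCommGroup E] [Module ℝ E]
    [FiniteDimensional ℝ E] [TopologicalSpace E] [ContinuousAdd E] [ContinuousSMul ℝ E]
    {s : Set E} (hs : IsCompact s) : IsCompact (convexHull ℝ s) := by
  obtain rfl | ⟨z₀, hz₀⟩ := s.eq_empty_or_nonempty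
  · simp
  set κ := Fin (Module.finrank ℝ E + 1)
  have hT : IsCompact (stdSimplex ℝ κ ×ˢ Set.pi Set.univ fun _ : κ => s) :=
    (isCompact_stdSimplex ℝ κ).prod (isCompact_univ_pi fun _ => hs)
  have hf : Continuous fun q : (κ → ℝ) × (κ → E) => ∑ j, q.1 j • q.2 j := by fun_prop
  convert hT.image hf using 1
  apply Set.Subset.antisymm
  · intro x hx
    obtain ⟨ι, _, z, w, hz, hind, hw, hw1, rfl⟩ := eq_pos_convex_span_of_mem_convexHull hx
    have hcard : Fintype.card ι ≤ Fintype.card κ := by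
      simpa [κ] using hind.card_le_finrank_succ.trans
        (Nat.add_le_add_right (Submodule.finrank_le _) 1)
    obtain ⟨e⟩ := Function.Embedding.nonempty_of_card_le hcard
    have hzero : ∀ j ∉ Set.range e, Function.extend e w 0 j = 0 := fun j hj =>
      Function.extend_apply' _ _ _ (by simpa using hj)
    refine ⟨(Function.extend e w 0, Function.extend e z fun _ => z₀), ⟨⟨fun j => ?_, ?_⟩, ?_⟩, ?_⟩
    · by_cases hj : j ∈ Set.range e
      · obtain ⟨i, rfl⟩ := hj
        simpa [e.injective.extend_apply] using (hw i).le
      · exact (hzero j hj).ge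
    · rw [← hw1]
      exact (Fintype.sum_of_injective e e.injective _ _ hzero
        fun i => (e.injective.extend_apply _ _ i).symm).symm
    · intro j _
      by_cases hj : j ∈ Set.range e
      · obtain ⟨i, rfl⟩ := hj
        simpa [e.injective.extend_apply] using hz ⟨i, rfl⟩
      · simpa [Function.extend_apply' _ _ _ hj] using hz₀
    · refine (Fintype.sum_of_injective e e.injective _ _ (fun j hj => ?_) fun i => ?_).symm
      · simp [hzero j hj]
      · simp [e.injective.extend_apply]
  · rintro _ ⟨q, ⟨hq, hqs⟩, rfl⟩
    exact (convex_convexHull ℝ s).sum_mem (fun j _ => hq.1 j) hq.2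
      fun j _ => subset_convexHull ℝ s (hqs j trivial)

/-- Every real-linear functional on complex matrices is, on Hermitian matrices, the trace
pairing with a Hermitian matrix. -/
theorem exists_isHermitian_re_trace_mul_eq {n : Type*} [Fintype n] [DecidableEq n]
    (φ : Matrix n n ℂ →ₗ[ℝ] ℝ) :
    ∃ h : Matrix n n ℂ, h.IsHermitian ∧
      ∀ x : Matrix n n ℂ, x.IsHermitian → ((x * h).trace).re = φ x := by
  let g : Matrix n n ℂ := Matrix.of fun j i =>
    (φ (Matrix.single i j 1) : ℂ) - φ (Matrix.single i j Complex.I) * Complex.I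
  have hg : ∀ x : Matrix n n ℂ, ((x * g).trace).re = φ x := by
    intro x
    have hx : x = ∑ i, ∑ j, ((x i j).re • Matrix.single i j (1 : ℂ) +
        (x i j).im • Matrix.single i j Complex.I) := by
      conv_lhs => rw [Matrix.matrix_eq_sum_single x]
      refine Finset.sum_congr rfl fun i _ => Finset.sum_congr rfl fun j _ => ?_
      rw [Matrix.smul_single, Matrix.smul_single, ← Matrix.single_add]
      congr 1
      simp [Complex.re_add_im]
    conv_rhs => rw [hx]
    simp only [map_sum, map_add, map_smul]
    simp [Matrix.trace, Matrix.mul_apply, g]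
  refine ⟨(1 / 2 : ℝ) • (g + gᴴ), ?_, fun x hx => ?_⟩
  · rw [Matrix.IsHermitian, Matrix.conjTranspose_smul, Matrix.conjTranspose_add,
      Matrix.conjTranspose_conjTranspose, add_comm]
    simp
  · have hconj : ((x * gᴴ).trace).re = φ x := by
      rw [← hg x, Matrix.trace_mul_comm x g]
      conv_lhs => rw [← hx.eq, ← Matrix.conjTranspose_mul, Matrix.trace_conjTranspose]
      simp
    rw [Matrix.mul_smul, Matrix.trace_smul, Complex.smul_re, Matrix.mul_add, Matrix.trace_add,
      Complex.add_re, hg, hconj, smul_eq_mul]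
    ring

section Entropy

variable {n : Type*} [Fintype n] [DecidableEq n]

/-- The Shannon entropy of the diagonal of `Uᴴ σ U`. -/
noncomputable def diagEntropy (U σ : Matrix n n ℂ) : ℝ :=
  ∑ k, Real.negMulLog ((Uᴴ * σ * U) k k).re

theorem sum_normSq_row_of_mem_unitaryGroup {W : Matrix n n ℂ} (hW : W ∈ Matrix.unitaryGroup n ℂ)
    (k : n) : ∑ j, Complex.normSq (W k j) = 1 := by
  have h := congrFun (congrFun (Matrix.mem_unitaryGroup_iff.1 hW) k) k
  rw [Matrix.mul_apply, Matrix.one_apply_eq] at h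
  have h' := congrArg Complex.re h
  simpa [Matrix.star_apply, Complex.mul_conj, ← Complex.ofReal_sum] using h'

theorem sum_normSq_col_of_mem_unitaryGroup {W : Matrix n n ℂ} (hW : W ∈ Matrix.unitaryGroup n ℂ)
    (j : n) : ∑ k, Complex.normSq (W k j) = 1 := by
  simpa [Matrix.star_apply] using
    sum_normSq_row_of_mem_unitaryGroup (Unitary.star_mem hW) j

theorem Matrix.IsHermitian.conj_apply_self_re {σ : Matrix n n ℂ} (hσ : σ.IsHermitian)
    (U : Matrix n n ℂ) (k : n) :
    ((Uᴴ * σ * U) k k).re = ∑ j, Complex.normSq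
      ((Uᴴ * (hσ.eigenvectorUnitary : Matrix n n ℂ)) k j) * hσ.eigenvalues j := by
  set W := Uᴴ * (hσ.eigenvectorUnitary : Matrix n n ℂ) with hW
  have h : Uᴴ * σ * U = W * Matrix.diagonal (fun j => (hσ.eigenvalues j : ℂ)) * Wᴴ := by
    conv_lhs => rw [hσ.spectral_theorem, Unitary.conjStarAlgAut_apply]
    simp only [hW, Matrix.conjTranspose_mul, Matrix.conjTranspose_conjTranspose, Matrix.mul_assoc,
      Matrix.star_eq_conjTranspose]
    rfl
  rw [h, Matrix.mul_apply, Complex.re_sum]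
  refine Finset.sum_congr rfl fun j _ => ?_
  rw [Matrix.mul_diagonal, Matrix.conjTranspose_apply, Complex.star_def, mul_right_comm,
    Complex.mul_conj, ← Complex.ofReal_mul, Complex.ofReal_re]

theorem vonNeumannEntropy_le_diagEntropy {σ : Matrix n n ℂ} (hσ : σ.PosSemidef)
    {U : Matrix n n ℂ} (hU : U ∈ Matrix.unitaryGroup n ℂ) :
    vonNeumannEntropy σ ≤ diagEntropy U σ := by
  have hH := hσ.isHermitian
  set W := Uᴴ * (hH.eigenvectorUnitary : Matrix n n ℂ) with hW
  have hWmem : W ∈ Matrix.unitaryGroup n ℂ :=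
    mul_mem (Unitary.star_mem hU) hH.eigenvectorUnitary.2
  have hJ : ∀ k, ∑ j, Complex.normSq (W k j) * Real.negMulLog (hH.eigenvalues j) ≤
      Real.negMulLog ((Uᴴ * σ * U) k k).re := by
    intro k
    rw [hH.conj_apply_self_re]
    simpa using Real.concaveOn_negMulLog.le_map_sum (t := Finset.univ)
      (w := fun j => Complex.normSq (W k j)) (p := hH.eigenvalues)
      (fun j _ => Complex.normSq_nonneg _) (sum_normSq_row_of_mem_unitaryGroup hWmem k)
      (fun j _ => hσ.eigenvalues_nonneg j)
  rw [vonNeumannEntropy, dif_pos hH]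
  calc ∑ j, Real.negMulLog (hH.eigenvalues j)
      = ∑ j, (∑ k, Complex.normSq (W k j)) * Real.negMulLog (hH.eigenvalues j) := by
        simp [sum_normSq_col_of_mem_unitaryGroup hWmem]
    _ = ∑ k, ∑ j, Complex.normSq (W k j) * Real.negMulLog (hH.eigenvalues j) := by
        simp_rw [Finset.sum_mul]
        exact Finset.sum_comm
    _ ≤ diagEntropy U σ := Finset.sum_le_sum fun k _ => hJ k

theorem diagEntropy_eigenvectorUnitary {σ : Matrix n n ℂ} (hσ : σ.IsHermitian) :
    diagEntropy (hσ.eigenvectorUnitary : Matrix n n ℂ) σ = vonNeumannEntropy σ := by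
  have h1 : (hσ.eigenvectorUnitary : Matrix n n ℂ)ᴴ * (hσ.eigenvectorUnitary : Matrix n n ℂ) = 1 :=
    Unitary.coe_star_mul_self _
  rw [vonNeumannEntropy, dif_pos hσ, diagEntropy]
  refine Finset.sum_congr rfl fun k _ => ?_
  rw [hσ.conj_apply_self_re, h1]
  congr 1
  rw [Finset.sum_eq_single k] <;> simp +contextual [eq_comm]

theorem vonNeumannEntropy_eq_sInf_diagEntropy {σ : Matrix n n ℂ} (hσ : σ.PosSemidef) :
    vonNeumannEntropy σ =
      sInf ((fun U => diagEntropy U σ) '' (Matrix.unitaryGroup n ℂ : Set (Matrix n n ℂ))) := by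
  have h : IsLeast ((fun U => diagEntropy U σ) '' (Matrix.unitaryGroup n ℂ : Set (Matrix n n ℂ)))
      (vonNeumannEntropy σ) := by
    refine ⟨⟨_, hσ.isHermitian.eigenvectorUnitary.2, diagEntropy_eigenvectorUnitary _⟩, ?_⟩
    rintro _ ⟨U, hU, rfl⟩
    exact vonNeumannEntropy_le_diagEntropy hσ hU
  exact h.csInf_eq.symm

theorem isCompact_unitaryGroup : IsCompact (Matrix.unitaryGroup n ℂ : Set (Matrix n n ℂ)) := by
  have hK : IsCompact (Set.pi Set.univ fun _ : n => Set.pi Set.univ fun _ : n =>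
      Metric.closedBall (0 : ℂ) 1) :=
    isCompact_univ_pi fun _ => isCompact_univ_pi fun _ => isCompact_closedBall _ _
  refine IsCompact.of_isClosed_subset (s := (Set.pi Set.univ fun _ : n => Set.pi Set.univ
    fun _ : n => Metric.closedBall (0 : ℂ) 1 : Set (Matrix n n ℂ))) hK ?_ ?_
  · have : (Matrix.unitaryGroup n ℂ : Set (Matrix n n ℂ)) = {U | U * Uᴴ = 1} := by
      ext U
      exact Matrix.mem_unitaryGroup_iff
    rw [this]
    exact isClosed_eq (by fun_prop) continuous_const
  · intro U hU i _ j _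
    simpa using entry_norm_bound_of_unitary hU i j

theorem Continuous.diagEntropy {m X : Type*} [Fintype m] [TopologicalSpace X]
    {U σ : X → Matrix m m ℂ} (hU : Continuous U) (hσ : Continuous σ) :
    Continuous fun x => diagEntropy (U x) (σ x) :=
  continuous_finsetSum _ fun k _ => Real.continuous_negMulLog.comp <| Complex.continuous_re.comp <|
    ((hU.matrix_conjTranspose.matrix_mul hσ).matrix_mul hU).matrix_elem k k

/-- The von Neumann entropy is continuous on positive semidefinite matrices. -/
theorem Continuous.vonNeumannEntropy {X : Type*} [TopologicalSpace X] {f : X → Matrix n n ℂ}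
    (hf : Continuous f) (hpos : ∀ x, (f x).PosSemidef) :
    Continuous fun x => vonNeumannEntropy (f x) := by
  simp_rw [fun x => vonNeumannEntropy_eq_sInf_diagEntropy (hpos x)]
  have h : Continuous fun q : X × Matrix n n ℂ => _root_.diagEntropy q.2 (f q.1) :=
    continuous_snd.diagEntropy (hf.comp continuous_fst)
  exact isCompact_unitaryGroup.continuous_sInf (f := fun x U => _root_.diagEntropy U (f x)) h

/-- The von Neumann entropy is concave on positive semidefinite matrices. -/
theorem concaveOn_vonNeumannEntropy :
    ConcaveOn ℝ {σ : Matrix n n ℂ | σ.PosSemidef} vonNeumannEntropy := by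
  have hconv : Convex ℝ {σ : Matrix n n ℂ | σ.PosSemidef} := fun x hx y hy a b ha hb _ =>
    (hx.smul ha).add (hy.smul hb)
  refine ⟨hconv, fun x hx y hy a b ha hb hab => ?_⟩
  have hz := hconv hx hy ha hb hab
  have hU := hz.isHermitian.eigenvectorUnitary.2
  set U := (hz.isHermitian.eigenvectorUnitary : Matrix n n ℂ)
  rw [← diagEntropy_eigenvectorUnitary hz.isHermitian]
  refine (add_le_add (smul_le_smul_of_nonneg_left (vonNeumannEntropy_le_diagEntropy hx hU) ha)
    (smul_le_smul_of_nonneg_left (vonNeumannEntropy_le_diagEntropy hy hU) hb)).trans ?_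
  simp only [diagEntropy, Finset.smul_sum, ← Finset.sum_add_distrib]
  have hdiag : ∀ τ : Matrix n n ℂ, τ.PosSemidef → ∀ k, 0 ≤ ((Uᴴ * τ * U) k k).re :=
    fun τ hτ k => (Complex.le_def.1 (hτ.conjTranspose_mul_mul_same U).diag_nonneg).1
  refine Finset.sum_le_sum fun k _ => ?_
  refine (Real.concaveOn_negMulLog.2 (hdiag x hx k) (hdiag y hy k) ha hb hab).trans_eq ?_
  congr 1
  simp [Matrix.mul_add, Matrix.add_mul, U]

theorem IsDensityMatrix.sum_eigenvalues {σ : Matrix n n ℂ} (hσ : IsDensityMatrix σ) :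
    ∑ i, hσ.1.isHermitian.eigenvalues i = 1 := by
  have h := congrArg Complex.re hσ.1.isHermitian.trace_eq_sum_eigenvalues
  simpa [hσ.2] using h.symm

theorem IsDensityMatrix.vonNeumannEntropy_nonneg {σ : Matrix n n ℂ} (hσ : IsDensityMatrix σ) :
    0 ≤ vonNeumannEntropy σ := by
  have hH := hσ.1.isHermitian
  rw [vonNeumannEntropy, dif_pos hH]
  refine Finset.sum_nonneg fun i _ => Real.negMulLog_nonneg (hσ.1.eigenvalues_nonneg i) ?_
  rw [← hσ.sum_eigenvalues]
  exact Finset.single_le_sum (fun j _ => hσ.1.eigenvalues_nonneg j) (Finset.mem_univ i)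

end Entropy

section PureStates

variable {I : Type*}

theorem posSemidef_outer [Finite I] (ψ : I → ℂ) : (outer ψ).PosSemidef :=
  Matrix.posSemidef_vecMulVec_self_star ψ

theorem continuous_outer : Continuous (outer : (I → ℂ) → Matrix I I ℂ) :=
  continuous_matrix fun i j => by
    simp only [outer, Matrix.of_apply]
    fun_prop

variable [Fintype I]

variable (I) in
/-- The unit sphere of `ℂ^I`. -/
def pureStates : Set (I → ℂ) := {ψ | ∑ z, Complex.normSq (ψ z) = 1}

theorem isCompact_pureStates : IsCompact (pureStates I) := by
  refine (isCompact_univ_pi fun _ : I => isCompact_closedBall (0 : ℂ) 1).of_isClosed_subset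
    (isClosed_eq (by fun_prop) continuous_const) fun ψ hψ z _ => ?_
  have h : Complex.normSq (ψ z) ≤ 1 := by
    rw [← hψ]
    exact Finset.single_le_sum (f := fun z => Complex.normSq (ψ z))
      (fun _ _ => Complex.normSq_nonneg _) (Finset.mem_univ z)
  rw [mem_closedBall_zero_iff, ← sq_le_one_iff₀ (norm_nonneg _), ← Complex.normSq_eq_norm_sq]
  exact h

variable [DecidableEq I]

theorem isDensityMatrix_outer {ψ : I → ℂ} (hψ : ψ ∈ pureStates I) :
    IsDensityMatrix (outer ψ) := by
  refine ⟨posSemidef_outer ψ, ?_⟩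
  simp only [Matrix.trace, Matrix.diag_apply, outer, Matrix.of_apply, Complex.mul_conj]
  exact_mod_cast hψ

theorem IsDensityMatrix.exists_eq_sum_smul_outer {σ : Matrix I I ℂ} (hσ : IsDensityMatrix σ) :
    ∃ (w : I → ℝ) (ψ : I → I → ℂ), (∀ i, 0 ≤ w i) ∧ ∑ i, w i = 1 ∧
      (∀ i, ψ i ∈ pureStates I) ∧ ∑ i, w i • outer (ψ i) = σ := by
  have hH := hσ.1.isHermitian
  refine ⟨hH.eigenvalues, fun i z => (hH.eigenvectorUnitary : Matrix I I ℂ) z i,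
    hσ.1.eigenvalues_nonneg, hσ.sum_eigenvalues,
    fun i => sum_normSq_col_of_mem_unitaryGroup hH.eigenvectorUnitary.2 i, ?_⟩
  conv_rhs => rw [hH.spectral_theorem, Unitary.conjStarAlgAut_apply]
  ext x y
  rw [Matrix.mul_apply, Matrix.sum_apply]
  refine Finset.sum_congr rfl fun i _ => ?_
  rw [Matrix.mul_diagonal, Matrix.star_apply, Matrix.smul_apply, outer, Matrix.of_apply,
    Complex.real_smul]
  simp only [Function.comp_apply, Complex.star_def, Complex.coe_algebraMap]
  ring

end PureStates

section PartialTrace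

variable {A B : Type*} [Fintype A]

/-- The partial trace as a real-linear map. -/
noncomputable def ptraceALinear : Matrix (A × B) (A × B) ℂ →ₗ[ℝ] Matrix B B ℂ where
  toFun := ptraceA
  map_add' x y := by
    ext
    simp [ptraceA, Finset.sum_add_distrib]
  map_smul' c x := by
    ext
    simp [ptraceA, Finset.mul_sum]

theorem continuous_ptraceA :
    Continuous (ptraceA : Matrix (A × B) (A × B) ℂ → Matrix B B ℂ) :=
  continuous_matrix fun i j => by
    simp only [ptraceA, Matrix.of_apply]
    exact continuous_finsetSum _ fun a _ => continuous_id.matrix_elem _ _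

theorem Matrix.PosSemidef.ptraceA {σ : Matrix (A × B) (A × B) ℂ} (hσ : σ.PosSemidef) :
    (ptraceA σ).PosSemidef := by
  have h : _root_.ptraceA σ = ∑ a, σ.submatrix (Prod.mk a) (Prod.mk a) := by
    ext
    simp [_root_.ptraceA, Matrix.sum_apply]
  rw [h]
  exact Matrix.posSemidef_sum _ fun a _ => hσ.submatrix _

variable [Fintype B] [DecidableEq B]

theorem concaveOn_vonNeumannEntropy_ptraceA :
    ConcaveOn ℝ {σ : Matrix (A × B) (A × B) ℂ | σ.PosSemidef}
      fun σ => vonNeumannEntropy (ptraceA σ) := by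
  refine ConcaveOn.subset (concaveOn_vonNeumannEntropy.comp_linearMap ptraceALinear)
    (fun σ hσ => Matrix.PosSemidef.ptraceA hσ) ?_
  exact fun x hx y hy a b ha hb _ => (hx.smul ha).add (hy.smul hb)

variable (A B) in
/-- Pairs of a pure-state projector and its reduced-state entropy. -/
def pureEntropyGraph : Set (Matrix (A × B) (A × B) ℂ × ℝ) :=
  (fun ψ => (outer ψ, vonNeumannEntropy (ptraceA (outer ψ)))) '' pureStates (A × B)

theorem isCompact_pureEntropyGraph : IsCompact (pureEntropyGraph A B) :=
  isCompact_pureStates.image <| continuous_outer.prodMk <|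
    (continuous_ptraceA.comp continuous_outer).vonNeumannEntropy
      fun ψ => (posSemidef_outer ψ).ptraceA

variable [DecidableEq A]

theorem IsDensityMatrix.ptraceA {σ : Matrix (A × B) (A × B) ℂ} (hσ : IsDensityMatrix σ) :
    IsDensityMatrix (ptraceA σ) := by
  refine ⟨hσ.1.ptraceA, ?_⟩
  rw [← hσ.2]
  simp only [Matrix.trace, Matrix.diag_apply, _root_.ptraceA, Matrix.of_apply,
    Fintype.sum_prod_type]
  exact Finset.sum_comm

theorem mem_pureDecompVals_iff {ρ : Matrix (A × B) (A × B) ℂ} {t : ℝ} :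
    t ∈ pureDecompVals ρ ↔ (ρ, t) ∈ convexHull ℝ (pureEntropyGraph A B) := by
  constructor
  · rintro ⟨N, p, ψ, hp, hp1, hψ, rfl, rfl⟩
    have h := (convex_convexHull ℝ (pureEntropyGraph A B)).sum_mem (t := Finset.univ)
      (fun i _ => (hp i).le) hp1 fun i _ => subset_convexHull ℝ _ ⟨ψ i, hψ i, rfl⟩
    convert h using 1
    ext1
    · simp [Prod.fst_sum, Complex.coe_smul]
    · simp [Prod.snd_sum]
  · intro h
    obtain ⟨ι, _, z, w, hz, -, hw, hw1, hsum⟩ := eq_pos_convex_span_of_mem_convexHull h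
    choose ψ hψ hψz using fun i => hz ⟨i, rfl⟩
    let e := Fintype.equivFin ι
    refine ⟨Fintype.card ι, w ∘ e.symm, ψ ∘ e.symm, fun i => hw _, ?_, fun i => hψ _, ?_, ?_⟩
    · rw [← hw1]
      exact e.symm.sum_comp w
    · have h1 : (∑ i, w i • z i).1 = ρ := congrArg Prod.fst hsum
      rw [Prod.fst_sum] at h1
      rw [← h1, ← e.symm.sum_comp]
      simp [← hψz, Complex.coe_smul]
    · have h2 : (∑ i, w i • z i).2 = t := congrArg Prod.snd hsum
      rw [Prod.snd_sum] at h2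
      rw [← h2, ← e.symm.sum_comp]
      simp [← hψz]

theorem pureDecompVals_nonempty {ρ : Matrix (A × B) (A × B) ℂ} (hρ : IsDensityMatrix ρ) :
    (pureDecompVals ρ).Nonempty := by
  obtain ⟨w, ψ, hw, hw1, hψ, hsum⟩ := hρ.exists_eq_sum_smul_outer
  refine ⟨∑ i, w i * vonNeumannEntropy (ptraceA (outer (ψ i))), mem_pureDecompVals_iff.2 ?_⟩
  have h := (convex_convexHull ℝ (pureEntropyGraph A B)).sum_mem (t := Finset.univ)
    (fun i _ => hw i) hw1 fun i _ => subset_convexHull ℝ _ ⟨ψ i, hψ i, rfl⟩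
  convert h using 1
  ext1
  · simp [Prod.fst_sum, hsum]
  · simp [Prod.snd_sum]

theorem pureDecompVals_nonneg {ρ : Matrix (A × B) (A × B) ℂ} {t : ℝ}
    (ht : t ∈ pureDecompVals ρ) : 0 ≤ t := by
  obtain ⟨N, p, ψ, hp, -, hψ, -, rfl⟩ := ht
  exact Finset.sum_nonneg fun i _ =>
    mul_nonneg (hp i).le (isDensityMatrix_outer (hψ i)).ptraceA.vonNeumannEntropy_nonneg

theorem re_trace_sum_smul_mul {I ι : Type*} [Fintype I] [Fintype ι] (w : ι → ℝ)
    (x : ι → Matrix I I ℂ) (h : Matrix I I ℂ) :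
    (((∑ i, w i • x i) * h).trace).re = ∑ i, w i * ((x i * h).trace).re := by
  simp [Finset.sum_mul, Matrix.trace_sum, Matrix.trace_smul]

/-- By concavity of the entropy, a functional below the reduced-state entropy on pure states is
below it on all states. -/
theorem re_trace_mul_le_vonNeumannEntropy_ptraceA {h : Matrix (A × B) (A × B) ℂ}
    (hpure : ∀ ψ ∈ pureStates (A × B),
      ((outer ψ * h).trace).re ≤ vonNeumannEntropy (ptraceA (outer ψ)))
    {σ : Matrix (A × B) (A × B) ℂ} (hσ : IsDensityMatrix σ) :
    ((σ * h).trace).re ≤ vonNeumannEntropy (ptraceA σ) := by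
  obtain ⟨w, ψ, hw, hw1, hψ, rfl⟩ := hσ.exists_eq_sum_smul_outer
  rw [re_trace_sum_smul_mul]
  refine (Finset.sum_le_sum fun i _ =>
    mul_le_mul_of_nonneg_left (hpure _ (hψ i)) (hw i)).trans ?_
  simpa using concaveOn_vonNeumannEntropy_ptraceA.le_map_sum (t := Finset.univ)
    (fun i _ => hw i) hw1 fun i _ => posSemidef_outer (ψ i)

/-- A trace functional below the reduced-state entropy is below every value of a pure-state
decomposition. -/
theorem re_trace_mul_le_of_mem_pureDecompVals {h ρ : Matrix (A × B) (A × B) ℂ}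
    (hle : ∀ σ : Matrix (A × B) (A × B) ℂ, IsDensityMatrix σ →
      ((σ * h).trace).re ≤ vonNeumannEntropy (ptraceA σ))
    {t : ℝ} (ht : t ∈ pureDecompVals ρ) : ((ρ * h).trace).re ≤ t := by
  obtain ⟨N, p, ψ, hp, -, hψ, rfl, rfl⟩ := ht
  simp only [Complex.coe_smul]
  rw [re_trace_sum_smul_mul]
  exact Finset.sum_le_sum fun i _ =>
    mul_le_mul_of_nonneg_left (hle _ (isDensityMatrix_outer (hψ i))) (hp i).le

/-- Separating the compact convex hull of the entropy graph from a vertical half-line below it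
yields a trace functional that is nearly optimal at `ρ`. -/
theorem exists_isHermitian_lt_re_trace_mul {ρ : Matrix (A × B) (A × B) ℂ}
    (hρ : IsDensityMatrix ρ) {r : ℝ} (hr : r < sInf (pureDecompVals ρ)) :
    ∃ h : Matrix (A × B) (A × B) ℂ, h.IsHermitian ∧
      (∀ σ : Matrix (A × B) (A × B) ℂ, IsDensityMatrix σ →
        ((σ * h).trace).re ≤ vonNeumannEntropy (ptraceA σ)) ∧ r < ((ρ * h).trace).re := by
  have : LocallyConvexSpace ℝ (Matrix (A × B) (A × B) ℂ) :=
    inferInstanceAs (LocallyConvexSpace ℝ (A × B → A × B → ℂ))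
  have hdisj : Disjoint (convexHull ℝ (pureEntropyGraph A B)) ({ρ} ×ˢ Set.Iic r) := by
    rw [Set.disjoint_left]
    rintro ⟨x, t⟩ hx ⟨rfl : x = ρ, ht : t ≤ r⟩
    exact (hr.trans_le (csInf_le ⟨0, fun _ => pureDecompVals_nonneg⟩
      (mem_pureDecompVals_iff.2 hx))).not_ge ht
  obtain ⟨f, u, v, hfu, huv, hfv⟩ := geometric_hahn_banach_compact_closed
    (convex_convexHull ℝ (pureEntropyGraph A B))
    isCompact_pureEntropyGraph.convexHull_of_finiteDimensional
    ((convex_singleton ρ).prod (convex_Iic r)) (isClosed_singleton.prod isClosed_Iic) hdisj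
  set c := f (0, 1)
  have hf : ∀ x t, f (x, t) = f (x, 0) + t * c := fun x t => by
    rw [← smul_eq_mul, ← map_smul, ← map_add]
    simp
  obtain ⟨t₀, ht₀⟩ := pureDecompVals_nonempty hρ
  have htr : r < t₀ := hr.trans_le (csInf_le ⟨0, fun _ => pureDecompVals_nonneg⟩ ht₀)
  have hρr : v < f (ρ, r) := hfv _ ⟨rfl, Set.self_mem_Iic⟩
  have hc : c < 0 := by
    have h1 := hfu _ (mem_pureDecompVals_iff.1 ht₀)
    rw [hf] at h1 hρr
    nlinarith
  obtain ⟨g, hg, hgf⟩ := exists_isHermitian_re_trace_mul_eq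
    (f.toLinearMap ∘ₗ LinearMap.inl ℝ (Matrix (A × B) (A × B) ℂ) ℝ)
  replace hgf : ∀ x : Matrix (A × B) (A × B) ℂ, x.IsHermitian →
      ((x * g).trace).re = f (x, 0) := hgf
  have hval : ∀ x : Matrix (A × B) (A × B) ℂ, IsDensityMatrix x →
      ((x * ((-c)⁻¹ • (g - u • (1 : Matrix (A × B) (A × B) ℂ)))).trace).re =
        (f (x, 0) - u) / (-c) := by
    intro x hx
    rw [Matrix.mul_smul, Matrix.trace_smul, Complex.smul_re, Matrix.mul_sub, Matrix.trace_sub,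
      Complex.sub_re, hgf x hx.1.isHermitian, Matrix.mul_smul, Matrix.mul_one, Matrix.trace_smul,
      hx.2, smul_eq_mul, Complex.smul_re, Complex.one_re, smul_eq_mul, mul_one, inv_mul_eq_div]
  refine ⟨(-c)⁻¹ • (g - u • (1 : Matrix (A × B) (A × B) ℂ)), ?_, ?_, ?_⟩
  · simp [Matrix.IsHermitian, hg.eq]
  · refine fun σ hσ => re_trace_mul_le_vonNeumannEntropy_ptraceA (fun ψ hψ => ?_) hσ
    have h1 := hfu _ (subset_convexHull ℝ _ ⟨ψ, hψ, rfl⟩)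
    rw [hf] at h1
    rw [hval _ (isDensityMatrix_outer hψ), div_le_iff₀ (neg_pos.2 hc)]
    linarith
  · rw [hf] at hρr
    rw [hval _ hρ, lt_div_iff₀ (neg_pos.2 hc)]
    linarith

end PartialTrace

/-- The entanglement of formation equals the supremum of the affine functionals
lying below the reduced-state entropy. -/
theorem eof_eq_sup_affine_functionals
    {A B : Type*} [Fintype A] [Fintype B] [DecidableEq A] [DecidableEq B]
    (ρ : Matrix (A × B) (A × B) ℂ) (hρ : IsDensityMatrix ρ) :
    sInf (pureDecompVals ρ) =
      sSup {x : ℝ | ∃ h : Matrix (A × B) (A × B) ℂ, h.IsHermitian ∧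
        (∀ σ : Matrix (A × B) (A × B) ℂ, IsDensityMatrix σ →
          ((σ * h).trace).re ≤ vonNeumannEntropy (ptraceA σ)) ∧
        x = ((ρ * h).trace).re} := by
  have hbdd : BddBelow (pureDecompVals ρ) := ⟨0, fun _ => pureDecompVals_nonneg⟩
  have hne := pureDecompVals_nonempty hρ
  have hle : ∀ x ∈ {x : ℝ | ∃ h : Matrix (A × B) (A × B) ℂ, h.IsHermitian ∧
        (∀ σ : Matrix (A × B) (A × B) ℂ, IsDensityMatrix σ →
          ((σ * h).trace).re ≤ vonNeumannEntropy (ptraceA σ)) ∧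
        x = ((ρ * h).trace).re}, x ≤ sInf (pureDecompVals ρ) := by
    rintro _ ⟨h, -, hh, rfl⟩
    exact le_csInf hne fun t ht => re_trace_mul_le_of_mem_pureDecompVals hh ht
  apply le_antisymm
  · refine le_of_forall_lt fun r hr => ?_
    obtain ⟨h, hh, hhle, hlt⟩ := exists_isHermitian_lt_re_trace_mul hρ hr
    exact hlt.trans_le (le_csSup ⟨_, hle⟩ ⟨h, hh, hhle, rfl⟩)
  · refine csSup_le ⟨0, 0, Matrix.isHermitian_zero, fun σ hσ => ?_, by simp⟩ hle
    simpa using hσ.ptraceA.vonNeumannEntropy_nonneg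
end
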